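/- Let m ≥ 2 be an integer with (p, m) ≠ (2, 2). Then: (a) if x ∈ fil''_m W_s(K) and F(x) − x ∈ fil'_{m-1} W_s(K), then x ∈ fil''_{m-1} W_s(K) (so F−1 induces an injection fil''_m/fil''_{m-1} → fil'_m/fil'_{m-1}); (b) for a = (a_{s-1},…,a_0) ∈ fil'_m W_s(K), one has Σ_{i=0}^{s-1} a_i^{p^i−1} da_i ∈ fil'_{m-1} Ω¹_K if and only if a ∈ fil'_{m-1} W_s(K) + (F−1)(fil''_m W_s(K)). In other words, the sequence 0 → fil''_mW_s(K)/fil''_{m-1}W_s(K) → fil'_mW_s(K)/fil'_{m-1}W_s(K) → fil'_mΩ¹_K/fil'_{m-1}Ω¹_K, with first map induced by F−1 and second map induced by a ↦ −Σ a_i^{p^i−1}da_i, is exact. -/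

import Mathlib

/-!
Setting: `K` is a (complete) discrete valuation field of characteristic `p > 0`, with
normalized additive valuation `v = ord_K : K → ℤ ∪ {∞}` (normalization is expressed by
the existence of a uniformizer `π` with `v π = 1`).

`W_s(K)` is the ring of `p`-typical Witt vectors of length `s` over `K`.  Following the
paper, a Witt vector is written `a = (a_{s-1}, …, a_0)`, where the paper's component
`a_i` is the component of standard index `s - 1 - i` (so `a_{s-1}` is the leading
component and the Verschiebung `V` sends `(a_{s-1}, …, a_0)` to `(0, a_{s-1}, …, a_0)`,
i.e. it is the standard index shift).  We realize `W_s(K)` as `TruncatedWittVector p s K`.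
-/

noncomputable section

open TruncatedWittVector

variable (p : ℕ) [Fact p.Prime] (K : Type*) [Field K] [CharP K p]
variable (v : AddValuation K (WithTop ℤ))

/-- The Frobenius `F : W_s(K) → W_s(K)`, raising each component to the `p`-th power. -/
def frobW {s : ℕ} (a : TruncatedWittVector p s K) : TruncatedWittVector p s K :=
  TruncatedWittVector.mk p fun i => a.coeff i ^ p

/-- The `k`-fold Verschiebung `V^k : W_t(K) → W_s(K)` (for `t + k = s`), shifting
components: in the paper's notation it sends `(a_{t-1}, …, a_0)` to
`(0, …, 0, a_{t-1}, …, a_0)`. -/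
def VShift (k : ℕ) {t : ℕ} (s : ℕ) (a : TruncatedWittVector p t K) :
    TruncatedWittVector p s K :=
  TruncatedWittVector.mk p fun i =>
    if h : k ≤ (i : ℕ) ∧ (i : ℕ) - k < t then a.coeff ⟨(i : ℕ) - k, h.2⟩ else 0

/-- The truncation `pr_t : W_s(K) → W_t(K)`, `(a_{s-1}, …, a_0) ↦ (a_{s-1}, …, a_{s-t})`. -/
def prW {s : ℕ} (t : ℕ) (ht : t ≤ s) (a : TruncatedWittVector p s K) :
    TruncatedWittVector p t K :=
  TruncatedWittVector.mk p fun i => a.coeff (Fin.castLE ht i)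

/-- `ord_K(a) = min_{0 ≤ i ≤ s-1} p^i · ord_K(a_i)` for a Witt vector
`a = (a_{s-1}, …, a_0) ∈ W_s(K)` (the paper's component `a_i` has standard index
`s - 1 - i`, whence the weight `p ^ (s - 1 - i)` below). -/
def wittOrd {s : ℕ} (a : TruncatedWittVector p s K) : WithTop ℤ :=
  Finset.univ.inf fun i : Fin s => p ^ (s - 1 - (i : ℕ)) • v (a.coeff i)

/-- Brylinski--Kato filtration `fil_n W_s(K) = {a ∈ W_s(K) | ord_K(a) ≥ -n}`. -/
def filW (s : ℕ) (n : ℤ) : Set (TruncatedWittVector p s K) :=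
  {a | ((-n : ℤ) : WithTop ℤ) ≤ wittOrd p K v a}

/-- `fil^{(r)}_n W_s(K) = fil_{[n/p^r]} W_s(K)` (for `n ≥ 0`). -/
def filWr (s r : ℕ) (n : ℕ) : Set (TruncatedWittVector p s K) :=
  filW p K v s ((n / p ^ r : ℕ) : ℤ)

/-- Matsuda's filtration
`fil'_m W_s(K) = fil_{m-1} W_s(K) + V^{s-s'}(fil_m W_{s'}(K))`, `s' = min(ord_p m, s)`. -/
def filW' (s m : ℕ) : Set (TruncatedWittVector p s K) :=
  {a | ∃ b ∈ filW p K v s ((m : ℤ) - 1),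
      ∃ c ∈ filW p K v (min (padicValNat p m) s) (m : ℤ),
        a = b + VShift p K (s - min (padicValNat p m) s) s c}

/-- `fil'^{(r)}_m W_s(K) = fil^{(r)}_{m-1} W_s(K) + V^{s-s''}(fil^{(r)}_m W_{s''}(K))`,
where `s'' = max(0, min(ord_p m, s + r) - r)`. -/
def filW'r (s r m : ℕ) : Set (TruncatedWittVector p s K) :=
  {a | ∃ b ∈ filWr p K v s r (m - 1),
      ∃ c ∈ filWr p K v (min (padicValNat p m) (s + r) - r) r m,
        a = b + VShift p K (s - (min (padicValNat p m) (s + r) - r)) s c}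

/-- `fil''^{(r)}_m W_s(K) = fil^{(r)}_{[(m-1)/p]} W_s(K) + V^{s-s''}(fil^{(r)}_{[m/p]} W_{s''}(K))`,
where `s'' = max(0, min(ord_p m, s + r) - r)`. -/
def filW''r (s r m : ℕ) : Set (TruncatedWittVector p s K) :=
  {a | ∃ b ∈ filWr p K v s r ((m - 1) / p),
      ∃ c ∈ filWr p K v (min (padicValNat p m) (s + r) - r) r (m / p),
        a = b + VShift p K (s - (min (padicValNat p m) (s + r) - r)) s c}

/-- `fil''_m W_s(K) = fil''^{(0)}_m W_s(K)
  = fil_{[(m-1)/p]} W_s(K) + V^{s-s'}(fil_{[m/p]} W_{s'}(K))`. -/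
def filW'' (s m : ℕ) : Set (TruncatedWittVector p s K) :=
  filW''r p K v s 0 m

/-- The subfield `K^p ⊆ K` of `p`-th powers of `K`. -/
def Kp : Subfield K := Subfield.closure {x : K | ∃ y : K, y ^ p = x}

/-- The sum `∑_{i=0}^{s-1} a_i^{p^i - 1} d a_i ∈ Ω¹_K` attached to a Witt vector
`a = (a_{s-1}, …, a_0) ∈ W_s(K)` (the map `-F^{s-1} d` of the paper is its negative).
Here `Ω¹_K` is the module of Kähler differentials of `K` over its subfield `K^p`,
with universal derivation `d`. -/
def sumForm {s : ℕ} (a : TruncatedWittVector p s K) : KaehlerDifferential (Kp p K) K :=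
  ∑ i : Fin s, (a.coeff i ^ (p ^ (s - 1 - (i : ℕ)) - 1)) •
    KaehlerDifferential.D (Kp p K) K (a.coeff i)

/-- The non-logarithmic filtration `fil'_m Ω¹_K = 𝔪^{-m} Ω¹_{𝒪_K}`: the
`𝒪_K`-submodule of `Ω¹_K` generated by `{π^{-m} da : a ∈ 𝒪_K}` for a uniformizer `π`. -/
def filOmega' (π : K) (m : ℤ) : AddSubgroup (KaehlerDifferential (Kp p K) K) :=
  AddSubgroup.closure
    {ω | ∃ c a : K, 0 ≤ v c ∧ 0 ≤ v a ∧
        ω = (c * π ^ (-m)) • KaehlerDifferential.D (Kp p K) K a}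

section
set_option linter.unusedSectionVars false
variable {p K v}

theorem Derivation.ghostComponent_eq {A M : Type*} [CommRing A] [AddCommGroup M] [Module A M]
    (d : Derivation ℤ A M) (n : ℕ) (x : WittVector p A) :
    d (WittVector.ghostComponent n x) =
      (p ^ n : ℤ) • ∑ j ∈ Finset.range (n + 1),
        x.coeff j ^ (p ^ (n - j) - 1) • d (x.coeff j) := by
  rw [WittVector.ghostComponent_apply, wittPolynomial_eq_sum_C_mul_X_pow, map_sum, map_sum,
    Finset.smul_sum]
  refine Finset.sum_congr rfl fun j hj => ?_
  have hj' : p ^ n = p ^ j * p ^ (n - j) := by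
    rw [← pow_add, Nat.add_sub_of_le (Nat.lt_succ_iff.mp (Finset.mem_range.mp hj))]
  have h : (MvPolynomial.aeval x.coeff) (MvPolynomial.C ((p : ℤ) ^ j) *
      MvPolynomial.X j ^ p ^ (n - j)) = ((p ^ j : ℕ) : ℤ) • x.coeff j ^ p ^ (n - j) := by
    simp
  rw [h, map_smul, Derivation.leibniz_pow, ← Nat.cast_smul_eq_nsmul ℤ, smul_smul]
  congr 1
  exact_mod_cast hj'.symm

theorem Derivation.sum_coeff_add_of_torsionFree {A M : Type*} [CommRing A] [AddCommGroup M]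
    [Module A M] [IsAddTorsionFree M]
    (d : Derivation ℤ A M) (n : ℕ) (x y : WittVector p A) :
    ∑ j ∈ Finset.range (n + 1), (x + y).coeff j ^ (p ^ (n - j) - 1) • d ((x + y).coeff j) =
      ∑ j ∈ Finset.range (n + 1), x.coeff j ^ (p ^ (n - j) - 1) • d (x.coeff j) +
        ∑ j ∈ Finset.range (n + 1), y.coeff j ^ (p ^ (n - j) - 1) • d (y.coeff j) := by
  have hp : (p ^ n : ℤ) ≠ 0 := by exact_mod_cast pow_ne_zero n (Fact.out : p.Prime).ne_zero
  refine smul_right_injective M hp ?_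
  simp only [smul_add, ← Derivation.ghostComponent_eq, map_add]

/-- The map `x ↦ ∑ x_j ^ (p ^ (n - j) - 1) d x_j` on Witt vectors is additive. -/
theorem Derivation.sum_coeff_add {A M : Type*} [CommRing A] [AddCommGroup M] [Module A M]
    (d : Derivation ℤ A M) (n : ℕ) (x y : WittVector p A) :
    ∑ j ∈ Finset.range (n + 1), (x + y).coeff j ^ (p ^ (n - j) - 1) • d ((x + y).coeff j) =
      ∑ j ∈ Finset.range (n + 1), x.coeff j ^ (p ^ (n - j) - 1) • d (x.coeff j) +
        ∑ j ∈ Finset.range (n + 1), y.coeff j ^ (p ^ (n - j) - 1) • d (y.coeff j) := by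
  let f : MvPolynomial A ℤ →+* A := (MvPolynomial.aeval (R := ℤ) (id : A → A)).toRingHom
  let _ := f.toAlgebra
  have hf : Function.Surjective f := fun a => ⟨MvPolynomial.X a, by simp [f]⟩
  have : IsAddTorsionFree (Ω[MvPolynomial A ℤ⁄ℤ]) := by
    let b := (KaehlerDifferential.mvPolynomialBasis ℤ A).repr
    exact Function.Injective.isAddTorsionFree (f := b.toAddEquiv.toAddMonoidHom) b.injective
  obtain ⟨x, rfl⟩ := WittVector.map_surjective (p := p) f hf x
  obtain ⟨y, rfl⟩ := WittVector.map_surjective (p := p) f hf y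
  have key := congrArg
    (fun w => d.liftKaehlerDifferential (KaehlerDifferential.map ℤ ℤ (MvPolynomial A ℤ) A w))
    (Derivation.sum_coeff_add_of_torsionFree (KaehlerDifferential.D ℤ (MvPolynomial A ℤ)) n x y)
  have hs : ∀ z w : MvPolynomial A ℤ, d.liftKaehlerDifferential
      (KaehlerDifferential.map ℤ ℤ (MvPolynomial A ℤ) A (z • KaehlerDifferential.D ℤ _ w)) =
      f z • d (f w) := by
    intro z w
    rw [LinearMap.map_smul, KaehlerDifferential.map_D, algebra_compatible_smul A z,
      LinearMap.map_smul, Derivation.liftKaehlerDifferential_comp_D]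
    rfl
  have hT : ∀ z : WittVector p (MvPolynomial A ℤ), d.liftKaehlerDifferential
      (KaehlerDifferential.map ℤ ℤ (MvPolynomial A ℤ) A
        (∑ j ∈ Finset.range (n + 1), z.coeff j ^ (p ^ (n - j) - 1) •
          KaehlerDifferential.D ℤ (MvPolynomial A ℤ) (z.coeff j))) =
      ∑ j ∈ Finset.range (n + 1),
        (WittVector.map f z).coeff j ^ (p ^ (n - j) - 1) • d ((WittVector.map f z).coeff j) := by
    intro z
    rw [map_sum, map_sum]
    exact Finset.sum_congr rfl fun j _ => by rw [hs, map_pow f]; rfl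
  rw [← map_add (WittVector.map f), ← hT, ← hT, ← hT]
  exact key.trans (by rw [map_add, map_add]; rfl)

theorem Derivation.exists_pow_pred_smul_add {A M : Type*} [CommRing A] [AddCommGroup M]
    [Module A M] (d : Derivation ℤ A M) (f g : A) :
    ∃ h, (f + g) ^ (p - 1) • d (f + g) + d h = f ^ (p - 1) • d f + g ^ (p - 1) • d g := by
  have h := Derivation.sum_coeff_add d 1 (WittVector.teichmuller p f) (WittVector.teichmuller p g)
  simp only [Finset.sum_range_succ, Finset.sum_range_zero, zero_add, WittVector.add_coeff_zero,
    WittVector.teichmuller_coeff_zero, WittVector.teichmuller_coeff_pos _ _ _ one_pos, map_zero,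
    smul_zero, add_zero, Nat.sub_self, pow_zero, one_smul, Nat.sub_zero, pow_one] at h
  exact ⟨_, h⟩

/-! ### The form attached to a Witt vector -/

theorem sumForm_eq_sum_range {s : ℕ} (a : TruncatedWittVector p (s + 1) K) :
    sumForm p K a = ∑ j ∈ Finset.range (s + 1), a.out.coeff j ^ (p ^ (s - j) - 1) •
      (KaehlerDifferential.D (Kp p K) K).restrictScalars ℤ (a.out.coeff j) := by
  rw [Finset.sum_range, sumForm]
  refine Finset.sum_congr rfl fun i _ => ?_
  rw [coeff_out, show s + 1 - 1 - (i : ℕ) = s - i by omega]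
  rfl

theorem sumForm_add {s : ℕ} (a b : TruncatedWittVector p s K) :
    sumForm p K (a + b) = sumForm p K a + sumForm p K b := by
  cases s with
  | zero => simp [sumForm]
  | succ s =>
    simp only [sumForm_eq_sum_range]
    rw [← Derivation.sum_coeff_add]
    have h : ∀ j ∈ Finset.range (s + 1), (a + b).out.coeff j = (a.out + b.out).coeff j := by
      intro j hj
      obtain ⟨i, rfl⟩ : ∃ i : Fin (s + 1), (i : ℕ) = j := ⟨⟨j, Finset.mem_range.mp hj⟩, rfl⟩
      rw [coeff_out, ← WittVector.coeff_truncateFun, WittVector.truncateFun_add, truncateFun_out,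
        truncateFun_out]
    exact Finset.sum_congr rfl fun j hj => by rw [h j hj]

theorem sumForm_sub {s : ℕ} (a b : TruncatedWittVector p s K) :
    sumForm p K (a - b) = sumForm p K a - sumForm p K b := by
  rw [eq_sub_iff_add_eq, ← sumForm_add, sub_add_cancel]

theorem pow_p_mem_Kp (x : K) : x ^ p ∈ Kp p K :=
  Subfield.subset_closure ⟨x, rfl⟩

theorem D_of_mem_Kp {c : K} (hc : c ∈ Kp p K) :
    KaehlerDifferential.D (Kp p K) K c = 0 :=
  (KaehlerDifferential.D (Kp p K) K).map_algebraMap ⟨c, hc⟩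

theorem sumForm_frobW {s : ℕ} (a : TruncatedWittVector p s K) :
    sumForm p K (frobW p K a) = 0 :=
  Finset.sum_eq_zero fun i _ => by
    rw [frobW, coeff_mk, D_of_mem_Kp (pow_p_mem_Kp _), smul_zero]

/-! ### Homogeneity of the Witt vector operations -/

theorem WittVector.teichmuller_mul_eq_of_invertible {R : Type*} [CommRing R] [Invertible (p : R)]
    (r : R) (x : WittVector p R) :
    WittVector.teichmuller p r * x = WittVector.mk p fun n => r ^ p ^ n * x.coeff n := by
  refine (WittVector.ghostMap.bijective_of_invertible p R).1 (funext fun n => ?_)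
  rw [WittVector.ghostMap_apply, WittVector.ghostMap_apply, map_mul,
    WittVector.ghostComponent_teichmuller]
  simp only [WittVector.ghostComponent_apply, aeval_wittPolynomial, Finset.mul_sum]
  refine Finset.sum_congr rfl fun i hi => ?_
  rw [WittVector.coeff_mk, mul_pow, ← pow_mul, ← pow_add,
    Nat.add_sub_of_le (Nat.lt_succ_iff.mp (Finset.mem_range.mp hi))]
  ring

theorem WittVector.teichmuller_mul_eq {R : Type*} [CommRing R] (r : R) (x : WittVector p R) :
    WittVector.teichmuller p r * x = WittVector.mk p fun n => r ^ p ^ n * x.coeff n := by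
  let f : MvPolynomial R ℤ →+* R := (MvPolynomial.aeval (R := ℤ) (id : R → R)).toRingHom
  have hf : Function.Surjective f := fun a => ⟨MvPolynomial.X a, by simp [f]⟩
  obtain ⟨r, rfl⟩ := hf r
  obtain ⟨x, rfl⟩ := WittVector.map_surjective (p := p) f hf x
  have key : WittVector.teichmuller p r * x =
      WittVector.mk p fun n => r ^ p ^ n * x.coeff n := by
    let g : MvPolynomial R ℤ →+* MvPolynomial R ℚ := MvPolynomial.map (Int.castRingHom ℚ)
    have hg : Function.Injective g := MvPolynomial.map_injective _ Int.cast_injective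
    refine WittVector.map_injective (p := p) g hg ?_
    have : Invertible ((p : ℕ) : MvPolynomial R ℚ) := by
      have : Invertible ((p : ℕ) : ℚ) := invertibleOfNonzero
        (Nat.cast_ne_zero.mpr (Fact.out : p.Prime).ne_zero)
      exact (Invertible.map (MvPolynomial.C : ℚ →+* MvPolynomial R ℚ) (p : ℚ)).copy _ (by simp)
    rw [map_mul, WittVector.map_teichmuller, WittVector.teichmuller_mul_eq_of_invertible]
    ext n
    simp [WittVector.map_coeff]
  rw [← WittVector.map_teichmuller, ← map_mul, key]
  ext n
  simp [WittVector.map_coeff]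

/-! ### Valuations -/

theorem map_uniformizer_zpow {π : K} (hπ : v π = 1) (k : ℤ) :
    v (π ^ k) = (k : WithTop ℤ) := by
  have hnat : ∀ n : ℕ, v (π ^ n) = ((n : ℤ) : WithTop ℤ) := fun n => by
    rw [AddValuation.map_pow, hπ]
    norm_cast
    simp
  have hπ0 : π ≠ 0 := fun h => by simp [h] at hπ
  cases k with
  | ofNat n => simpa using hnat n
  | negSucc n =>
    rw [zpow_negSucc, AddValuation.map_inv, hnat]
    rfl

theorem uniformizer_ne_zero {π : K} (hπ : v π = 1) : π ≠ 0 := fun h => by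
  simp [h] at hπ

theorem exists_map_eq_coe {x : K} (hx : x ≠ 0) : ∃ k : ℤ, v x = k := by
  have := (AddValuation.ne_top_iff v).mpr hx
  exact ⟨(v x).untop this, (WithTop.coe_untop _ this).symm⟩

theorem le_map_iff_exists {π : K} (hπ : v π = 1) {n : ℤ} {x : K} :
    (n : WithTop ℤ) ≤ v x ↔ ∃ u, 0 ≤ v u ∧ x = π ^ n * u := by
  have h0 := uniformizer_ne_zero hπ
  constructor
  · intro h
    refine ⟨π ^ (-n) * x, ?_, by rw [← mul_assoc, ← zpow_add₀ h0]; simp⟩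
    rw [AddValuation.map_mul, map_uniformizer_zpow hπ]
    calc (0 : WithTop ℤ) = ((-n : ℤ) : WithTop ℤ) + (n : ℤ) := by norm_cast; simp
      _ ≤ _ := by gcongr
  · rintro ⟨u, hu, rfl⟩
    rw [AddValuation.map_mul, map_uniformizer_zpow hπ]
    exact le_add_of_nonneg_right hu

theorem nsmul_coe_int (q : ℕ) (k : ℤ) : q • (k : WithTop ℤ) = ((q * k : ℤ) : WithTop ℤ) := by
  rw [← WithTop.coe_nsmul, nsmul_eq_mul]

/-- For `x` with `v x = k`, weighted comparisons reduce to integers; `x = 0` is harmless. -/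
theorem coe_le_nsmul_map_iff {q : ℕ} (hq : q ≠ 0) {n : ℤ} {x : K} :
    (n : WithTop ℤ) ≤ q • v x ↔ ∀ k : ℤ, v x = k → n ≤ q * k := by
  by_cases hx : x = 0
  · subst hx
    obtain ⟨r, rfl⟩ := Nat.exists_eq_succ_of_ne_zero hq
    simp [succ_nsmul]
  · obtain ⟨k, hk⟩ := exists_map_eq_coe (v := v) hx
    simp only [hk, nsmul_coe_int, WithTop.coe_le_coe, WithTop.coe_inj]
    exact ⟨fun h _ hk => hk ▸ h, fun h => h k rfl⟩

/-! ### The filtration on Witt vectors -/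

theorem le_nsmul_map_sum {ι : Type*} {N : ℕ} {c : WithTop ℤ} {t : Finset ι} {f : ι → K}
    (h : ∀ i ∈ t, c ≤ p ^ N • v (f i)) : c ≤ p ^ N • v (∑ i ∈ t, f i) := by
  simp only [← AddValuation.map_pow] at h ⊢
  rw [sum_pow_char_pow]
  exact v.map_le_sum h

theorem le_nsmul_map_add {N : ℕ} {c : WithTop ℤ} {x y : K}
    (hx : c ≤ p ^ N • v x) (hy : c ≤ p ^ N • v y) : c ≤ p ^ N • v (x + y) := by
  simp only [← AddValuation.map_pow] at hx hy ⊢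
  rw [add_pow_char_pow]
  exact v.map_le_add hx hy

theorem le_nsmul_map_mul {q : ℕ} {c d e : ℤ} {x y : K} (he : e ≤ c + d)
    (hx : (c : WithTop ℤ) ≤ q • v x) (hy : (d : WithTop ℤ) ≤ q • v y) :
    (e : WithTop ℤ) ≤ q • v (x * y) := by
  rw [AddValuation.map_mul, smul_add]
  exact (WithTop.coe_le_coe.mpr he).trans (by push_cast; gcongr)

variable (v) in
/-- The subring of `K[T]` of polynomials whose coefficient of `T ^ i` has `p ^ N` times its
valuation at least `-(n * i)`. -/
def reesSubring (N : ℕ) (n : ℤ) : Subring (Polynomial K) where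
  carrier := {f | ∀ i : ℕ, ((-(n * i) : ℤ) : WithTop ℤ) ≤ p ^ N • v (f.coeff i)}
  mul_mem' {f g} hf hg i := by
    rw [Polynomial.coeff_mul]
    refine le_nsmul_map_sum fun ij hij => le_nsmul_map_mul ?_ (hf ij.1) (hg ij.2)
    rw [← Finset.HasAntidiagonal.mem_antidiagonal.mp hij]
    push_cast
    linarith
  one_mem' i := by
    rw [Polynomial.coeff_one]
    split_ifs with h
    · subst h
      simp
    · rw [coe_le_nsmul_map_iff (pow_ne_zero _ (Fact.out : p.Prime).ne_zero)]
      simp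
  add_mem' {f g} hf hg i := by
    rw [Polynomial.coeff_add]
    exact le_nsmul_map_add (hf i) (hg i)
  zero_mem' i := by
    rw [coe_le_nsmul_map_iff (pow_ne_zero _ (Fact.out : p.Prime).ne_zero)]
    simp
  neg_mem' {f} hf i := by
    rw [Polynomial.coeff_neg, AddValuation.map_neg]
    exact hf i

variable (v) in
/-- The ideal of `reesSubring v N n` given by the strict inequalities. -/
def reesIdeal (N : ℕ) (n : ℤ) : Ideal (reesSubring (p := p) v N n) where
  carrier := {f | ∀ i : ℕ, ((-(n * i) + 1 : ℤ) : WithTop ℤ) ≤ p ^ N • v (f.1.coeff i)}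
  zero_mem' i := by
    rw [coe_le_nsmul_map_iff (pow_ne_zero _ (Fact.out : p.Prime).ne_zero)]
    simp
  add_mem' {f g} hf hg i := by
    rw [Subring.coe_add, Polynomial.coeff_add]
    exact le_nsmul_map_add (hf i) (hg i)
  smul_mem' f g hg i := by
    rw [smul_eq_mul, Subring.coe_mul, Polynomial.coeff_mul]
    refine le_nsmul_map_sum fun ij hij => le_nsmul_map_mul ?_ (f.2 ij.1) (hg ij.2)
    rw [← Finset.HasAntidiagonal.mem_antidiagonal.mp hij]
    push_cast
    linarith

theorem mem_filW_iff {s : ℕ} {n : ℤ} {a : TruncatedWittVector p s K} :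
    a ∈ filW p K v s n ↔
      ∀ i : Fin s, ((-n : ℤ) : WithTop ℤ) ≤ p ^ (s - 1 - (i : ℕ)) • v (a.coeff i) := by
  simp [filW, wittOrd, Finset.le_inf_iff]

/-- Rescaling a bound on the component of index `j` of a Witt vector of length `s` to the
weight `p ^ (s - 1)`. -/
theorem coe_le_nsmul_map_iff_mul {N j : ℕ} (hj : j ≤ N) {c : ℤ} {x : K} :
    ((p ^ j * c : ℤ) : WithTop ℤ) ≤ p ^ N • v x ↔ (c : WithTop ℤ) ≤ p ^ (N - j) • v x := by
  have hp := (Fact.out : p.Prime).pos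
  rw [coe_le_nsmul_map_iff (by positivity), coe_le_nsmul_map_iff (by positivity)]
  refine forall₂_congr fun k _ => ?_
  have hN : ((p ^ N : ℕ) : ℤ) = p ^ j * (p ^ (N - j) : ℕ) := by
    rw [Nat.cast_pow, Nat.cast_pow, ← pow_add, Nat.add_sub_of_le hj]
  rw [hN, mul_assoc]
  exact mul_le_mul_iff_right₀ (by positivity)

theorem monomial_mem_reesSubring {N j : ℕ} {n : ℤ} {x : K}
    (hx : ((p ^ j * (-n) : ℤ) : WithTop ℤ) ≤ p ^ N • v x) :
    Polynomial.monomial (p ^ j) x ∈ reesSubring (p := p) v N n := fun i => by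
  rw [Polynomial.coeff_monomial]
  split_ifs with h
  · subst h
    convert hx using 2
    push_cast
    ring
  · rw [coe_le_nsmul_map_iff (pow_ne_zero _ (Fact.out : p.Prime).ne_zero)]
    simp

/-- The Witt vector `[T] * a` over `reesSubring v (s - 1) n` attached to `a ∈ fil_n W_s(K)`. -/
theorem exists_reesSubring_lift {s : ℕ} {n : ℤ} {a : TruncatedWittVector p s K}
    (ha : a ∈ filW p K v s n) :
    ∃ A : WittVector p (reesSubring (p := p) v (s - 1) n),
      WittVector.map (Subring.subtype _) A =
        WittVector.teichmuller p Polynomial.X * WittVector.map Polynomial.C a.out := by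
  have hmem : ∀ j, Polynomial.monomial (p ^ j) (a.out.coeff j) ∈
      reesSubring (p := p) v (s - 1) n := by
    intro j
    refine monomial_mem_reesSubring ?_
    by_cases hj : j < s
    · have h := mem_filW_iff.mp ha ⟨j, hj⟩
      rw [show j = ((⟨j, hj⟩ : Fin s) : ℕ) from rfl, coeff_out]
      exact (coe_le_nsmul_map_iff_mul (by simp; omega)).mpr h
    · have : a.out.coeff j = 0 := by simp [TruncatedWittVector.out, hj]
      rw [this, coe_le_nsmul_map_iff (pow_ne_zero _ (Fact.out : p.Prime).ne_zero)]
      simp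
  refine ⟨WittVector.mk p fun j => ⟨_, hmem j⟩, ?_⟩
  rw [WittVector.teichmuller_mul_eq]
  ext1 j
  rw [WittVector.map_coeff, WittVector.coeff_mk, WittVector.coeff_mk, WittVector.map_coeff,
    mul_comm]
  exact Polynomial.C_mul_X_pow_eq_monomial.symm

theorem coeff_sub_of_lift {R : Subring (Polynomial K)} {s : ℕ} {a b : TruncatedWittVector p s K}
    {A B : WittVector p R}
    (hA : WittVector.map (Subring.subtype _) A =
      WittVector.teichmuller p Polynomial.X * WittVector.map Polynomial.C a.out)
    (hB : WittVector.map (Subring.subtype _) B =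
      WittVector.teichmuller p Polynomial.X * WittVector.map Polynomial.C b.out) (i : Fin s) :
    ((A - B).coeff i : Polynomial K) =
      Polynomial.monomial (p ^ (i : ℕ)) ((a - b).coeff i) := by
  have h : WittVector.map (Subring.subtype _) (A - B) =
      WittVector.teichmuller p Polynomial.X * WittVector.map Polynomial.C (a.out - b.out) := by
    rw [map_sub, hA, hB, map_sub, mul_sub]
  rw [WittVector.teichmuller_mul_eq] at h
  have h' := congrArg (fun w => w.coeff (i : ℕ)) h
  simp only [WittVector.map_coeff, WittVector.coeff_mk, Subring.subtype_apply] at h'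
  rw [h', ← Polynomial.C_mul_X_pow_eq_monomial, mul_comm]
  congr 2

theorem sub_mem_filW {s : ℕ} {n : ℤ} {a b : TruncatedWittVector p s K}
    (ha : a ∈ filW p K v s n) (hb : b ∈ filW p K v s n) : a - b ∈ filW p K v s n := by
  obtain ⟨A, hA⟩ := exists_reesSubring_lift ha
  obtain ⟨B, hB⟩ := exists_reesSubring_lift hb
  refine mem_filW_iff.mpr fun i => ?_
  have h := ((A - B).coeff i).2 (p ^ (i : ℕ))
  rw [coeff_sub_of_lift hA hB, Polynomial.coeff_monomial, if_pos rfl] at h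
  refine (coe_le_nsmul_map_iff_mul (by omega)).mp (le_trans (le_of_eq ?_) h)
  exact WithTop.coe_inj.mpr (by push_cast; ring)

theorem zero_mem_filW {s : ℕ} {n : ℤ} : (0 : TruncatedWittVector p s K) ∈ filW p K v s n :=
  mem_filW_iff.mpr fun i => by
    rw [coeff_zero, coe_le_nsmul_map_iff (pow_ne_zero _ (Fact.out : p.Prime).ne_zero)]
    simp

theorem add_mem_filW {s : ℕ} {n : ℤ} {a b : TruncatedWittVector p s K}
    (ha : a ∈ filW p K v s n) (hb : b ∈ filW p K v s n) : a + b ∈ filW p K v s n := by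
  have := sub_mem_filW ha (sub_mem_filW zero_mem_filW hb)
  rwa [zero_sub, sub_neg_eq_add] at this

/-- The components of `a - b` are small when `a` and `b` agree componentwise modulo the next
step of the filtration. -/
theorem sub_mem_filW_of_coeff_sub {s : ℕ} {n : ℤ} {a b : TruncatedWittVector p s K}
    (ha : a ∈ filW p K v s n) (hb : b ∈ filW p K v s n)
    (hab : ∀ i : Fin s, ((-n + 1 : ℤ) : WithTop ℤ) ≤
      p ^ (s - 1 - (i : ℕ)) • v (a.coeff i - b.coeff i)) :
    a - b ∈ filW p K v s (n - 1) := by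
  obtain ⟨A, hA⟩ := exists_reesSubring_lift ha
  obtain ⟨B, hB⟩ := exists_reesSubring_lift hb
  have hp := (Fact.out : p.Prime).ne_zero
  have hcoe : ∀ {x : K} {N : ℕ} {c : ℤ}, (c : WithTop ℤ) ≤ p ^ N • v x ↔
      ∀ k : ℤ, v x = k → c ≤ (p ^ N : ℕ) * k := coe_le_nsmul_map_iff (pow_ne_zero _ hp)
  let J := reesIdeal (p := p) v (s - 1) n
  have hcoeff : ∀ (a : TruncatedWittVector p s K)
      (A : WittVector p (reesSubring (p := p) v (s - 1) n)), WittVector.map (Subring.subtype _) A =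
        WittVector.teichmuller p Polynomial.X * WittVector.map Polynomial.C a.out →
      ∀ j, (A.coeff j : Polynomial K) = Polynomial.monomial (p ^ j) (a.out.coeff j) := by
    intro a A hA j
    have h' := congrArg (fun w => w.coeff j) hA
    simp only [WittVector.teichmuller_mul_eq] at h'
    simp only [WittVector.map_coeff, WittVector.coeff_mk, Subring.subtype_apply] at h'
    rw [h', ← Polynomial.C_mul_X_pow_eq_monomial, mul_comm]
  have hAB : WittVector.map (Ideal.Quotient.mk J) A = WittVector.map (Ideal.Quotient.mk J) B := by
    ext j
    rw [WittVector.map_coeff, WittVector.map_coeff, Ideal.Quotient.eq]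
    intro l
    rw [AddSubgroupClass.coe_sub, hcoeff a A hA, hcoeff b B hB, ← map_sub, Polynomial.coeff_monomial]
    split_ifs with hl
    · by_cases hj : j < s
      · have h := hab ⟨j, hj⟩
        rw [← coeff_out, ← coeff_out, Fin.val_mk, ← coe_le_nsmul_map_iff_mul (by omega)] at h
        rw [← hl]
        refine le_trans (WithTop.coe_le_coe.mpr ?_) h
        have : (0 : ℤ) < p ^ j := by positivity
        push_cast
        nlinarith
      · have h0 : ∀ a : TruncatedWittVector p s K, a.out.coeff j = 0 := fun a => by
          simp [TruncatedWittVector.out, hj]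
        rw [h0, h0, hcoe]
        simp
    · rw [hcoe]
      simp
  refine mem_filW_iff.mpr fun i => ?_
  have hJ : (A - B).coeff i ∈ J := by
    rw [← Ideal.Quotient.eq_zero_iff_mem, ← WittVector.map_coeff, map_sub, hAB, sub_self,
      WittVector.zero_coeff]
  have h := hJ (p ^ (i : ℕ))
  rw [coeff_sub_of_lift hA hB, Polynomial.coeff_monomial, if_pos rfl, hcoe] at h
  rw [hcoe]
  intro k hk
  have h1 := h k hk
  have hi : ((p ^ (s - 1) : ℕ) : ℤ) = p ^ (i : ℕ) * (p ^ (s - 1 - i) : ℕ) := by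
    rw [Nat.cast_pow, Nat.cast_pow, ← pow_add, Nat.add_sub_of_le (by omega)]
  rw [hi] at h1
  have h2 : (0 : ℤ) < p ^ (i : ℕ) := by positivity
  push_cast at h1 ⊢
  by_contra! hlt
  have h3 : (p : ℤ) ^ (s - 1 - i) * k ≤ -n := by linarith
  nlinarith [mul_le_mul_of_nonneg_left h3 h2.le]

/-! ### Componentwise description of the filtrations -/

theorem filW_mono {s : ℕ} {n₁ n₂ : ℤ} (h : n₁ ≤ n₂) : filW p K v s n₁ ⊆ filW p K v s n₂ :=
  fun _ ha => (WithTop.coe_le_coe.mpr (neg_le_neg h)).trans ha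

theorem TruncatedWittVector.coeff_add_eq_of_lt {s t : ℕ} (ht : t ≤ s)
    {b c : TruncatedWittVector p s K} (hc : ∀ i : Fin s, (i : ℕ) < t → c.coeff i = 0)
    {i : Fin s} (hi : (i : ℕ) < t) : (b + c).coeff i = b.coeff i := by
  have hi' : i = Fin.castLE ht ⟨i, hi⟩ := rfl
  have h0 : TruncatedWittVector.truncate ht c = 0 := by
    ext j
    rw [TruncatedWittVector.coeff_truncate, TruncatedWittVector.coeff_zero]
    exact hc _ j.2
  rw [hi', ← TruncatedWittVector.coeff_truncate, ← TruncatedWittVector.coeff_truncate, map_add, h0,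
    add_zero]

theorem TruncatedWittVector.coeff_add_of_disjoint {s : ℕ} {b c : TruncatedWittVector p s K}
    (h : ∀ i, b.coeff i = 0 ∨ c.coeff i = 0) (i : Fin s) :
    (b + c).coeff i = b.coeff i + c.coeff i := by
  have hbc : (b + c).coeff i = (b.out + c.out).coeff i := by
    rw [← WittVector.coeff_truncateFun, WittVector.truncateFun_add, truncateFun_out,
      truncateFun_out]
  rw [hbc, WittVector.coeff_add_of_disjoint, coeff_out, coeff_out]
  intro j
  by_cases hj : j < s
  · have := h ⟨j, hj⟩
    rwa [← coeff_out, ← coeff_out] at this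
  · left
    simp [TruncatedWittVector.out, hj]

theorem exists_add_VShift_iff {s t : ℕ} (ht : t ≤ s) {n₁ n₂ : ℤ} (hn : n₁ ≤ n₂)
    {a : TruncatedWittVector p s K} :
    (∃ b ∈ filW p K v s n₁, ∃ c ∈ filW p K v t n₂, a = b + VShift p K (s - t) s c) ↔
      ∀ i : Fin s, ((-(if s - 1 - (i : ℕ) < t then n₂ else n₁) : ℤ) : WithTop ℤ) ≤
        p ^ (s - 1 - (i : ℕ)) • v (a.coeff i) := by
  have hz : ∀ {c : ℤ} {N : ℕ}, (c : WithTop ℤ) ≤ p ^ N • v (0 : K) := fun {c N} => by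
    rw [coe_le_nsmul_map_iff (pow_ne_zero _ (Fact.out : p.Prime).ne_zero)]
    simp
  constructor
  · rintro ⟨b, hb, c, hc, rfl⟩ i
    split_ifs with hi
    · refine mem_filW_iff.mp (add_mem_filW (filW_mono hn hb) (mem_filW_iff.mpr fun i => ?_)) i
      rw [VShift, coeff_mk]
      split_ifs with h
      · refine (mem_filW_iff.mp hc ⟨_, h.2⟩).trans (le_of_eq ?_)
        congr 2
        simp only
        omega
      · exact hz
    · rw [TruncatedWittVector.coeff_add_eq_of_lt (t := s - t) (by omega) _ (by omega)]
      · exact mem_filW_iff.mp hb i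
      · intro j hj
        rw [VShift, coeff_mk, dif_neg (by omega)]
  · intro h
    refine ⟨mk p fun i => if s - 1 - (i : ℕ) < t then 0 else a.coeff i, ?_,
      mk p fun i => a.coeff ⟨s - t + i, by omega⟩, ?_, ?_⟩
    · refine mem_filW_iff.mpr fun i => ?_
      have hi := h i
      rw [coeff_mk]
      split_ifs at hi ⊢
      · exact hz
      · exact hi
    · refine mem_filW_iff.mpr fun i => ?_
      have hi := h ⟨s - t + i, by omega⟩
      have hi2 := i.2
      rw [if_pos (by simp only; omega)] at hi
      rw [coeff_mk]
      refine hi.trans (le_of_eq ?_)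
      congr 2
      simp only
      omega
    · have hV : ∀ i : Fin s, (VShift p K (s - t) s (mk p fun i : Fin t =>
          a.coeff ⟨s - t + i, by omega⟩)).coeff i =
          if s - 1 - (i : ℕ) < t then a.coeff i else 0 := by
        intro i
        rw [VShift, coeff_mk]
        split_ifs with h1 h2 h2
        · rw [coeff_mk]
          congr 1
          ext
          simp only
          omega
        · omega
        · omega
        · rfl
      ext i
      rw [TruncatedWittVector.coeff_add_of_disjoint, hV, coeff_mk]
      · split_ifs <;> simp
      · intro j
        rw [hV, coeff_mk]
        split_ifs <;> simp

theorem mem_filW'_iff {s m : ℕ} {a : TruncatedWittVector p s K} :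
    a ∈ filW' p K v s m ↔ ∀ i : Fin s,
      ((-(if s - 1 - (i : ℕ) < padicValNat p m then (m : ℤ) else m - 1) : ℤ) : WithTop ℤ) ≤
        p ^ (s - 1 - (i : ℕ)) • v (a.coeff i) := by
  refine (exists_add_VShift_iff (min_le_right _ _) (by omega)).trans (forall_congr' fun i => ?_)
  have : s - 1 - (i : ℕ) < min (padicValNat p m) s ↔ s - 1 - (i : ℕ) < padicValNat p m := by
    omega
  simp only [this]

theorem filW'_eq_of_not_dvd {s m : ℕ} (hm : ¬ p ∣ m) :
    filW' p K v s m = filW p K v s ((m : ℤ) - 1) := by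
  ext a
  rw [mem_filW'_iff, mem_filW_iff, padicValNat.eq_zero_of_not_dvd hm]
  simp

theorem filW'_subset_filW {s m : ℕ} : filW' p K v s m ⊆ filW p K v s m := fun a ha =>
  mem_filW_iff.mpr fun i => le_trans (WithTop.coe_le_coe.mpr (by split_ifs <;> omega))
    (mem_filW'_iff.mp ha i)

theorem filW_subset_filW' {s m : ℕ} : filW p K v s ((m : ℤ) - 1) ⊆ filW' p K v s m := fun a ha =>
  mem_filW'_iff.mpr fun i => le_trans (WithTop.coe_le_coe.mpr (by split_ifs <;> omega))
    (mem_filW_iff.mp ha i)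

theorem filW''_eq {s m : ℕ} (hm : 1 ≤ m) : filW'' p K v s m = filW p K v s (m / p : ℕ) := by
  have hp := (Fact.out : p.Prime)
  ext a
  have h1 : filW'' p K v s m = {a | ∃ b ∈ filW p K v s ((m - 1) / p : ℕ),
      ∃ c ∈ filW p K v (min (padicValNat p m) s) (m / p : ℕ),
        a = b + VShift p K (s - min (padicValNat p m) s) s c} := by
    simp [filW'', filW''r, filWr]
  rw [h1, Set.mem_ofPred_eq, exists_add_VShift_iff (min_le_right _ _)
    (by exact_mod_cast Nat.div_le_div_right (Nat.sub_le m 1)), mem_filW_iff]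
  refine forall_congr' fun i => ?_
  split_ifs with hi
  · rfl
  rw [coe_le_nsmul_map_iff (pow_ne_zero _ hp.ne_zero),
    coe_le_nsmul_map_iff (pow_ne_zero _ hp.ne_zero)]
  refine forall₂_congr fun k _ => ?_
  by_cases hpm : p ∣ m
  · obtain ⟨M, rfl⟩ := hpm
    have hM : M ≠ 0 := by rintro rfl; simp at hm
    have h2 : (p * M - 1) / p = M - 1 := by
      obtain ⟨q, rfl⟩ := Nat.exists_eq_succ_of_ne_zero hM
      have : p * (q + 1) - 1 = p * q + (p - 1) := by
        have := hp.pos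
        rw [mul_add, mul_one]; omega
      rw [Nat.succ_eq_add_one, this, Nat.mul_add_div hp.pos,
        Nat.div_eq_of_lt (Nat.sub_lt hp.pos one_pos)]
      simp
    rw [h2, Nat.mul_div_cancel_left _ hp.pos]
    have h3 : ((p ^ (s - 1 - (i : ℕ)) : ℕ) : ℤ) * k ≠ -(M : ℤ) := by
      intro h
      have h4 : p ^ (s - 1 - (i : ℕ)) ∣ M := by
        rw [← Int.natCast_dvd_natCast]
        exact (Int.dvd_neg).mp ⟨k, h.symm⟩
      have h5 := (padicValNat_dvd_iff_le hM).mp h4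
      rw [padicValNat.mul hp.ne_zero hM, padicValNat.self hp.one_lt] at hi
      omega
    omega
  · obtain ⟨q, rfl⟩ := Nat.exists_eq_add_of_le' hm
    rw [Nat.succ_div, if_neg hpm]
    rfl

theorem mem_filW_of_frobW_mem {s m : ℕ} {x : TruncatedWittVector p s K}
    (hx : frobW p K x ∈ filW p K v s m) : x ∈ filW p K v s (m / p : ℕ) := by
  have hp := (Fact.out : p.Prime)
  refine mem_filW_iff.mpr fun i => ?_
  have hi := mem_filW_iff.mp hx i
  rw [frobW, coeff_mk, AddValuation.map_pow, ← mul_nsmul',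
    coe_le_nsmul_map_iff (mul_ne_zero (pow_ne_zero _ hp.ne_zero) hp.ne_zero)] at hi
  rw [coe_le_nsmul_map_iff (pow_ne_zero _ hp.ne_zero)]
  intro k hk
  have h := hi k hk
  rw [neg_le, Int.natCast_div, Int.le_ediv_iff_mul_le (by exact_mod_cast hp.pos)]
  push_cast at h ⊢
  linarith

theorem frobW_mem_filW {s : ℕ} {n m : ℤ} (h : p * n ≤ m) {x : TruncatedWittVector p s K}
    (hx : x ∈ filW p K v s n) : frobW p K x ∈ filW p K v s m := by
  have hp := (Fact.out : p.Prime)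
  refine mem_filW_iff.mpr fun i => ?_
  have hi := mem_filW_iff.mp hx i
  rw [coe_le_nsmul_map_iff (pow_ne_zero _ hp.ne_zero)] at hi
  rw [frobW, coeff_mk, AddValuation.map_pow, ← mul_nsmul',
    coe_le_nsmul_map_iff (mul_ne_zero (pow_ne_zero _ hp.ne_zero) hp.ne_zero)]
  intro k hk
  have h1 := mul_le_mul_of_nonneg_left (hi k hk) (Int.natCast_nonneg p)
  push_cast at h1 ⊢
  linarith

theorem Nat.Prime.div_add_two_le {p m : ℕ} (hp : p.Prime) (hm : 2 ≤ m)
    (hpm : ¬(p = 2 ∧ m = 2)) : m / p + 2 ≤ m := by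
  rcases hp.two_le.eq_or_lt with rfl | h
  · omega
  · have : m / p ≤ m / 3 := Nat.div_le_div_left h (by norm_num)
    omega

theorem div_pred_of_not_dvd {p m : ℕ} (hm : 1 ≤ m) (h : ¬ p ∣ m) : (m - 1) / p = m / p := by
  obtain ⟨q, rfl⟩ := Nat.exists_eq_add_of_le' hm
  rw [Nat.succ_div, if_neg h]
  rfl

theorem mem_filW''_pred {s m : ℕ} (hm : 2 ≤ m) (hpm : ¬(p = 2 ∧ m = 2))
    {x : TruncatedWittVector p s K} (hx : x ∈ filW'' p K v s m)
    (hFx : frobW p K x - x ∈ filW' p K v s (m - 1)) : x ∈ filW'' p K v s (m - 1) := by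
  have hp := (Fact.out : p.Prime)
  rw [filW''_eq (by omega)] at hx ⊢
  by_cases h : p ∣ m
  · have h1 : ¬ p ∣ m - 1 := fun h' => hp.one_lt.ne' <| Nat.dvd_one.mp <| by
      simpa [Nat.sub_sub_self (by omega : 1 ≤ m)] using Nat.dvd_sub h h'
    have h2 := hp.div_add_two_le hm hpm
    have h3 : ((m - 1 : ℕ) : ℤ) - 1 = (m - 2 : ℕ) := by omega
    rw [filW'_eq_of_not_dvd h1, h3] at hFx
    have h4 := add_mem_filW hFx (filW_mono (n₂ := (m - 2 : ℕ)) (by omega) hx)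
    rw [sub_add_cancel] at h4
    refine filW_mono ?_ (mem_filW_of_frobW_mem h4)
    exact_mod_cast Nat.div_le_div_right (by omega)
  · rwa [div_pred_of_not_dvd (by omega) h]

/-! ### The filtration on differential forms -/

theorem smul_D_mem_filOmega' {π : K} (hπ : v π = 1) {n : ℤ} {c a : K}
    (hc : ((-n : ℤ) : WithTop ℤ) ≤ v c) (ha : 0 ≤ v a) :
    c • KaehlerDifferential.D (Kp p K) K a ∈ filOmega' p K v π n := by
  obtain ⟨u, hu, rfl⟩ := (le_map_iff_exists hπ).mp hc
  exact AddSubgroup.subset_closure ⟨u, a, hu, ha, by rw [mul_comm]⟩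

theorem smul_mem_filOmega' {π : K} (hπ : v π = 1) {n l : ℤ} {c : K}
    (hc : ((-n : ℤ) : WithTop ℤ) ≤ v c)
    {ω : KaehlerDifferential (Kp p K) K} (hω : ω ∈ filOmega' p K v π l) :
    c • ω ∈ filOmega' p K v π (n + l) := by
  induction hω using AddSubgroup.closure_induction with
  | mem x hx =>
    obtain ⟨d, a, hd, ha, rfl⟩ := hx
    rw [smul_smul]
    refine smul_D_mem_filOmega' hπ ?_ ha
    rw [AddValuation.map_mul, AddValuation.map_mul, map_uniformizer_zpow hπ, neg_add,
      WithTop.coe_add]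
    gcongr
    exact le_add_of_nonneg_left hd
  | zero => simp
  | add x y _ _ hx hy => rw [smul_add]; exact add_mem hx hy
  | neg x _ hx => rw [smul_neg]; exact neg_mem hx

theorem D_zpow (x : K) (k : ℤ) :
    KaehlerDifferential.D (Kp p K) K (x ^ k) =
      (k * x ^ (k - 1)) • KaehlerDifferential.D (Kp p K) K x := by
  have := (KaehlerDifferential.D (Kp p K) K).leibniz_zpow x k
  rw [this, ← Int.cast_smul_eq_zsmul K, smul_smul]

/-- The basic form `b ^ (q - 1) db` written in terms of the unit part of `b`. -/
theorem pow_pred_smul_D_eq {π : K} (hπ : π ≠ 0) {q : ℕ} (hq : q ≠ 0) (k : ℤ) (u : K) :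
    (π ^ k * u) ^ (q - 1) • KaehlerDifferential.D (Kp p K) K (π ^ k * u) =
      (π ^ (q * k)) • u ^ (q - 1) • KaehlerDifferential.D (Kp p K) K u +
      (k * π ^ (q * k - 1) * u ^ q) • KaehlerDifferential.D (Kp p K) K π := by
  obtain ⟨r, rfl⟩ := Nat.exists_eq_succ_of_ne_zero hq
  rw [Derivation.leibniz, D_zpow, smul_add, smul_smul, smul_smul, smul_smul, smul_smul]
  have h1 : π ^ (((r.succ : ℕ) : ℤ) * k) = (π ^ k) ^ r * π ^ k := by
    rw [← pow_succ, ← zpow_natCast, ← zpow_mul, mul_comm]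
  congr 2
  · rw [h1, mul_pow, Nat.succ_sub_one]; ring
  · rw [zpow_sub₀ hπ, zpow_sub₀ hπ, h1, mul_pow, Nat.succ_sub_one, pow_succ]; ring

/-! ### Approximate derivations -/

section NullSequences

open Filter Polynomial

variable (v) in
/-- The space of sequences in `K` that converge to zero. -/
def nullSeq : Submodule K (ℕ → K) where
  carrier := {f | ∀ N : ℤ, ∀ᶠ n in atTop, (N : WithTop ℤ) ≤ v (f n)}
  add_mem' hf hg N := by
    filter_upwards [hf N, hg N] with n h1 h2 using v.map_le_add h1 h2
  zero_mem' N := by simp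
  smul_mem' c f hf N := by
    rcases eq_or_ne c 0 with rfl | hc
    · simp
    obtain ⟨k, hk⟩ := exists_map_eq_coe (v := v) hc
    filter_upwards [hf (N - k)] with n h
    rw [Pi.smul_apply, smul_eq_mul, AddValuation.map_mul, hk]
    calc (N : WithTop ℤ) = (k : WithTop ℤ) + (N - k : ℤ) := by norm_cast; ring_nf
      _ ≤ _ := by gcongr

theorem mul_mem_nullSeq {f g : ℕ → K} (hf : f ∈ nullSeq v) {M : ℤ}
    (hg : ∀ᶠ n in atTop, (M : WithTop ℤ) ≤ v (g n)) : f * g ∈ nullSeq v := fun N => by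
  filter_upwards [hf (N - M), hg] with n h1 h2
  rw [Pi.mul_apply, AddValuation.map_mul]
  calc (N : WithTop ℤ) = ((N - M : ℤ) : WithTop ℤ) + (M : ℤ) := by norm_cast; ring_nf
    _ ≤ _ := by gcongr

theorem eventually_le_of_sub_mem_nullSeq {f : ℕ → K} {a : K} (h : (fun n => f n - a) ∈ nullSeq v) :
    ∃ M : ℤ, ∀ᶠ n in atTop, (M : WithTop ℤ) ≤ v (f n) := by
  obtain ⟨M, hM⟩ : ∃ M : ℤ, (M : WithTop ℤ) ≤ v a := by
    rcases eq_or_ne a 0 with rfl | ha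
    · exact ⟨0, by simp⟩
    · obtain ⟨k, hk⟩ := exists_map_eq_coe (v := v) ha
      exact ⟨k, hk.ge⟩
  refine ⟨M, ?_⟩
  filter_upwards [h M] with n hn
  simpa using v.map_le_add hn hM

variable {K₁ : Subfield K} {z : K}

/-- `P ↦ P'(z)` scales as expected under multiplication by powers of `π ^ p`. -/
theorem le_map_aeval_derivative {π : K} (hπ : v π = 1) (hK : Kp p K ≤ K₁)
    (h1 : ∀ P : K₁[X], 0 ≤ v (aeval z P) → 0 ≤ v (aeval z (derivative P))) {k : ℤ} {P : K₁[X]}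
    (hP : ((p * k : ℤ) : WithTop ℤ) ≤ v (aeval z P)) :
    ((p * k : ℤ) : WithTop ℤ) ≤ v (aeval z (derivative P)) := by
  have h0 := uniformizer_ne_zero hπ
  have hmem : ∀ k : ℤ, π ^ (p * k) ∈ K₁ := fun k => by
    rw [zpow_mul, zpow_natCast]
    exact zpow_mem (hK (pow_p_mem_Kp π)) k
  let c : K₁ := ⟨π ^ (p * -k), hmem _⟩
  have hc : ∀ Q : K₁[X], aeval z (C c * Q) = π ^ (p * -k) * aeval z Q := fun Q => by
    rw [map_mul, aeval_C]
    rfl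
  have hle : ∀ x : K, ((p * k : ℤ) : WithTop ℤ) ≤ v x ↔ 0 ≤ v (π ^ (p * -k) * x) := by
    intro x
    rcases eq_or_ne x 0 with rfl | hx
    · simp
    obtain ⟨l, hl⟩ := exists_map_eq_coe (v := v) hx
    rw [AddValuation.map_mul, map_uniformizer_zpow hπ, hl]
    norm_cast
    rw [mul_neg]
    omega
  rw [hle] at hP ⊢
  rw [← hc] at hP ⊢
  rw [← derivative_C_mul]
  exact h1 _ hP

theorem aeval_derivative_mem_nullSeq {π : K} (hπ : v π = 1) (hK : Kp p K ≤ K₁)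
    (h1 : ∀ P : K₁[X], 0 ≤ v (aeval z P) → 0 ≤ v (aeval z (derivative P))) {P : ℕ → K₁[X]}
    (hP : (fun n => aeval z (P n)) ∈ nullSeq v) :
    (fun n => aeval z (derivative (P n))) ∈ nullSeq v := fun N => by
  have hp := (Fact.out : p.Prime)
  have hle : N ≤ p * |N| := (le_abs_self N).trans
    (le_mul_of_one_le_left (abs_nonneg _) (by exact_mod_cast hp.one_le))
  filter_upwards [hP (p * |N|)] with n hn
  exact (WithTop.coe_le_coe.mpr hle).trans (le_map_aeval_derivative hπ hK h1 hn)

/-- The derivation with values in sequences modulo null sequences, given by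
`x ↦ (P_n'(z))_n` where `P_n(z)` converges to `x`. -/
theorem exists_derivation {π : K} (hπ : v π = 1) (hK : Kp p K ≤ K₁)
    (h1 : ∀ P : K₁[X], 0 ≤ v (aeval z P) → 0 ≤ v (aeval z (derivative P)))
    (h2 : ∀ (x : K) (N : ℤ), ∃ P : K₁[X], (N : WithTop ℤ) ≤ v (x - aeval z P)) :
    ∃ d : Derivation (Kp p K) K ((ℕ → K) ⧸ nullSeq v), ∀ (x : K) (P : ℕ → K₁[X]),
      (fun n => aeval z (P n) - x) ∈ nullSeq v →
        d x = (nullSeq v).mkQ fun n => aeval z (derivative (P n)) := by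
  choose P hP using h2
  have hP' : ∀ x, (fun n : ℕ => aeval z (P x n) - x) ∈ nullSeq v := fun x N => by
    filter_upwards [eventually_ge_atTop N.toNat] with n hn
    rw [AddValuation.map_sub_swap]
    exact (WithTop.coe_le_coe.mpr (by omega)).trans (hP x n)
  let δ : K → (ℕ → K) ⧸ nullSeq v := fun x =>
    (nullSeq v).mkQ fun n : ℕ => aeval z (derivative (P x n))
  have key : ∀ (x : K) (Q : ℕ → K₁[X]), (fun n => aeval z (Q n) - x) ∈ nullSeq v →
      δ x = (nullSeq v).mkQ fun n => aeval z (derivative (Q n)) := by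
    intro x Q hQ
    refine (Submodule.Quotient.eq _).mpr ?_
    have := aeval_derivative_mem_nullSeq hπ hK h1 (P := fun n => P x n - Q n)
      (by convert sub_mem (hP' x) hQ using 1; ext n; simp)
    convert this using 1
    ext n
    simp
  let D : K →ₗ[Kp p K] (ℕ → K) ⧸ nullSeq v :=
    { toFun := δ
      map_add' := fun x y => by
        rw [key (x + y) (fun n => P x n + P y n), ← map_add]
        · congr 1
          ext n
          simp
        · convert add_mem (hP' x) (hP' y) using 1
          ext n
          simp
          ring
      map_smul' := fun c x => by
        have hc : ∀ Q : K₁[X], aeval z (C ⟨c.1, hK c.2⟩ * Q) = c.1 * aeval z Q := fun Q => by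
          rw [map_mul, aeval_C]
          rfl
        rw [key (c • x) (fun n => C ⟨c.1, hK c.2⟩ * P x n)]
        · simp only [derivative_C_mul, hc]
          rfl
        · convert (nullSeq v).smul_mem c.1 (hP' x) using 1
          ext n
          rw [hc, Pi.smul_apply, smul_eq_mul, mul_sub]
          rfl }
  refine ⟨Derivation.mk' D fun x y => ?_, key⟩
  change δ (x * y) = x • δ y + y • δ x
  obtain ⟨M, hM⟩ := eventually_le_of_sub_mem_nullSeq (hP' x)
  have hder : ∀ x, ∃ M : ℤ, ∀ᶠ n : ℕ in atTop, (M : WithTop ℤ) ≤ v (aeval z (derivative (P x n))) := by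
    intro x
    obtain ⟨M, hM⟩ := eventually_le_of_sub_mem_nullSeq (hP' x)
    have hle : p * -|M| ≤ M := by
      have h3 : |M| ≤ p * |M| := le_mul_of_one_le_left (abs_nonneg _)
        (by exact_mod_cast (Fact.out : p.Prime).one_le)
      have h4 := neg_abs_le M
      linarith
    refine ⟨p * -|M|, ?_⟩
    filter_upwards [hM] with n hn
    exact le_map_aeval_derivative hπ hK h1 ((WithTop.coe_le_coe.mpr hle).trans hn)
  obtain ⟨Mx, hMx⟩ := hder x
  obtain ⟨My, hMy⟩ := hder y
  rw [key (x * y) (fun n => P x n * P y n)]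
  · refine (Submodule.Quotient.eq _).mpr ?_
    convert add_mem (mul_mem_nullSeq (hP' x) hMy) (mul_mem_nullSeq (hP' y) hMx) using 1
    ext n
    simp
    ring
  · convert add_mem (mul_mem_nullSeq (hP' y) hM) ((nullSeq v).smul_mem y (hP' x)) using 1
    ext n
    simp
    ring

theorem exists_polynomial_of_sum_mem {π : K} (hπ : v π = 1) (hK : Kp p K ≤ K₁)
    (h1 : ∀ P : K₁[X], 0 ≤ v (aeval z P) → 0 ≤ v (aeval z (derivative P)))
    (h2 : ∀ (x : K) (N : ℤ), ∃ P : K₁[X], (N : WithTop ℤ) ≤ v (x - aeval z P))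
    {ι : Type*} {t : Finset ι} {c x : ι → K} {n : ℤ}
    (h : ∑ i ∈ t, c i • KaehlerDifferential.D (Kp p K) K (x i) ∈ filOmega' p K v π n) (N : ℤ) :
    ∃ P : ι → K₁[X], (∀ i, (N : WithTop ℤ) ≤ v (x i - aeval z (P i))) ∧
      ((-n : ℤ) : WithTop ℤ) ≤ v (∑ i ∈ t, c i * aeval z (derivative (P i))) := by
  obtain ⟨d, hd⟩ := exists_derivation hπ hK h1 h2
  choose P hP using h2
  have hP' : ∀ x, (fun n : ℕ => aeval z (P x n) - x) ∈ nullSeq v := fun x N => by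
    filter_upwards [eventually_ge_atTop N.toNat] with n hn
    rw [AddValuation.map_sub_swap]
    exact (WithTop.coe_le_coe.mpr (by omega)).trans (hP x n)
  have hL : ∀ ω ∈ filOmega' p K v π n, ∃ f : ℕ → K,
      d.liftKaehlerDifferential ω = (nullSeq v).mkQ f ∧
        ∀ k, ((-n : ℤ) : WithTop ℤ) ≤ v (f k) := by
    intro ω hω
    induction hω using AddSubgroup.closure_induction with
    | mem ω hω =>
      obtain ⟨b, a, hb, ha, rfl⟩ := hω
      refine ⟨(b * π ^ (-n)) • fun k : ℕ => aeval z (derivative (P a k)), ?_, fun k => ?_⟩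
      · rw [map_smul, Derivation.liftKaehlerDifferential_comp_D, hd a (fun k => P a k) (hP' a),
          map_smul]
      · rw [Pi.smul_apply, smul_eq_mul, AddValuation.map_mul, AddValuation.map_mul,
          map_uniformizer_zpow hπ]
        refine le_trans (le_add_of_nonneg_left hb) (le_add_of_nonneg_right (h1 _ ?_))
        have h3 : (0 : WithTop ℤ) ≤ v (a - aeval z (P a k)) :=
          le_trans (WithTop.coe_le_coe.mpr (Int.natCast_nonneg k)) (hP a k)
        simpa using v.map_le_sub ha h3
    | zero => exact ⟨0, by simp, by simp⟩
    | add ω₁ ω₂ _ _ hω₁ hω₂ =>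
      obtain ⟨f₁, hf₁, hf₁'⟩ := hω₁
      obtain ⟨f₂, hf₂, hf₂'⟩ := hω₂
      exact ⟨f₁ + f₂, by rw [map_add, hf₁, hf₂, map_add],
        fun k => v.map_le_add (hf₁' k) (hf₂' k)⟩
    | neg ω _ hω =>
      obtain ⟨f, hf, hf'⟩ := hω
      exact ⟨-f, by rw [map_neg, hf, map_neg], fun k => by
        rw [Pi.neg_apply, AddValuation.map_neg]; exact hf' k⟩
  obtain ⟨f, hf, hf'⟩ := hL _ h
  have hsum : d.liftKaehlerDifferential
      (∑ i ∈ t, c i • KaehlerDifferential.D (Kp p K) K (x i)) =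
      (nullSeq v).mkQ (∑ i ∈ t, c i • fun k : ℕ => aeval z (derivative (P (x i) k))) := by
    rw [map_sum, map_sum]
    refine Finset.sum_congr rfl fun i _ => ?_
    rw [map_smul, Derivation.liftKaehlerDifferential_comp_D, map_smul,
      hd (x i) (fun k => P (x i) k) (hP' _)]
  rw [hsum] at hf
  have hnull := (Submodule.Quotient.eq _).mp hf
  obtain ⟨k, hk, hkN⟩ := ((hnull (-n)).and (eventually_ge_atTop N.toNat)).exists
  refine ⟨fun i => P (x i) k, fun i => ?_, ?_⟩
  · exact (WithTop.coe_le_coe.mpr (by omega)).trans (hP (x i) k)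
  · simpa using v.map_le_add hk (hf' k)

end NullSequences

/-! ### The Cartier operator on polynomials -/

section Polynomial

open Polynomial

variable {F : Type*} [Field F] [CharP F p]

theorem natCast_descFactorial_pred (n : ℕ) :
    (((n + 1) * p - 1).descFactorial (p - 1) : F) = -1 := by
  have hp := (Fact.out : p.Prime)
  have h1 : (((n + 1) * p - 1).descFactorial (p - 1) : ZMod p) = -1 := by
    rw [Nat.descFactorial_eq_prod_range, Nat.cast_prod,
      ← Finset.prod_range_reflect, ← ZMod.wilsons_lemma p, ← Finset.prod_range_add_one_eq_factorial,
      Nat.cast_prod]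
    refine Finset.prod_congr rfl fun i hi => ?_
    have hi' := Finset.mem_range.mp hi
    have : (n + 1) * p - 1 - (p - 1 - 1 - i) = n * p + (i + 1) := by
      rw [add_mul, one_mul]
      omega
    rw [this]
    simp
  have h2 := congrArg (ZMod.castHom dvd_rfl F) h1
  simpa using h2

theorem Polynomial.iterate_derivative_pow_mul (g f : F[X]) (n : ℕ) :
    derivative^[n] (g ^ p * f) = g ^ p * derivative^[n] f := by
  induction n generalizing f with
  | zero => rfl
  | succ n ih =>
    rw [Function.iterate_succ_apply, Function.iterate_succ_apply, derivative_mul, derivative_pow]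
    simp [ih]

theorem Polynomial.iterate_derivative_char (f : F[X]) : derivative^[p] f = 0 := by
  rw [← factorial_smul_hasseDeriv]
  have : ((p.factorial : ℕ) : F[X]) = 0 :=
    (CharP.cast_eq_zero_iff F[X] p _).mpr (Nat.dvd_factorial (Fact.out : p.Prime).pos le_rfl)
  rw [LinearMap.smul_apply, nsmul_eq_mul, this, zero_mul]

theorem Polynomial.pow_pred_mul_derivative_add (f g : F[X]) :
    ∃ h, (f + g) ^ (p - 1) * derivative (f + g) + derivative h =
      f ^ (p - 1) * derivative f + g ^ (p - 1) * derivative g := by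
  exact Derivation.exists_pow_pred_smul_add ((derivative' (R := F)).restrictScalars ℤ) f g

theorem Polynomial.iterate_derivative_pow_pred_mul_derivative (f : F[X]) :
    derivative^[p - 1] (f ^ (p - 1) * derivative f) = -(derivative f) ^ p := by
  have hp := (Fact.out : p.Prime)
  have hp1 : p - 1 + 1 = p := Nat.sub_add_cancel hp.one_le
  induction f using Polynomial.induction_on' with
  | add f g hf hg =>
    obtain ⟨h, hh⟩ := pow_pred_mul_derivative_add (p := p) f g
    have h0 : derivative^[p - 1] (derivative h) = 0 := by
      rw [← Function.iterate_succ_apply, Nat.succ_eq_add_one, hp1, iterate_derivative_char]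
    have h1 := congrArg (derivative^[p - 1]) hh
    rw [iterate_map_add, h0, add_zero, iterate_map_add, hf, hg] at h1
    rw [h1, derivative_add, add_pow_char]
    ring
  | monomial n a =>
    cases n with
    | zero => simp [hp.ne_zero]
    | succ n =>
      have h1 : (monomial (n + 1) a) ^ (p - 1) * derivative (monomial (n + 1) a) =
          C (a ^ p * (n + 1)) * X ^ ((n + 1) * p - 1) := by
        have h2 : (n + 1) * p - 1 = (n + 1) * (p - 1) + n := by
          obtain ⟨q, hq⟩ : ∃ q, p = q + 1 := ⟨p - 1, hp1.symm⟩
          rw [hq]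
          simp [mul_add]
        rw [derivative_monomial, monomial_pow, monomial_mul_monomial, h2,
          C_mul_X_pow_eq_monomial, ← mul_assoc, ← pow_succ, hp1]
        simp
      have h3 : ((n + 1 : ℕ) : F) ^ p = (n + 1 : ℕ) := by
        rw [← frobenius_def, map_natCast]
      have h4 : (n + 1) * p - 1 - (p - 1) = n * p := by
        rw [add_mul, one_mul]
        omega
      rw [h1, iterate_derivative_C_mul, iterate_derivative_X_pow_eq_natCast_mul, h4,
        ← C_eq_natCast, natCast_descFactorial_pred, derivative_monomial, monomial_pow, mul_pow, h3,
        Nat.add_sub_cancel, ← C_mul_X_pow_eq_monomial]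
      simp

/-- If `∑ f_i ^ (p ^ i - 1) f_i'` lies in a subgroup stable under derivation, closed under taking
`p`-th roots and under multiplication by the `f_i`, then so does every `f_i'`. -/
theorem Polynomial.derivative_mem_of_sum_mem {R : Subring F[X]} {I : AddSubgroup F[X]}
    (hD : ∀ f ∈ I, derivative f ∈ I) (hroot : ∀ f, f ^ p ∈ I → f ∈ I)
    (hmul : ∀ f ∈ R, ∀ g ∈ I, f * g ∈ I) {t : ℕ} {f : ℕ → F[X]} (hf : ∀ i, f i ∈ R)
    (h : ∑ i ∈ Finset.range t, f i ^ (p ^ i - 1) * derivative (f i) ∈ I) :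
    ∀ i < t, derivative (f i) ∈ I := by
  have hp := (Fact.out : p.Prime)
  have hp1 : p - 1 + 1 = p := Nat.sub_add_cancel hp.one_le
  induction t generalizing f with
  | zero => simp
  | succ t ih =>
    rw [Finset.sum_range_succ'] at h
    have hiter : ∀ n, ∀ g ∈ I, derivative^[n] g ∈ I := by
      intro n
      induction n with
      | zero => exact fun g hg => hg
      | succ n ihn => exact fun g hg => ihn _ (hD g hg)
    have hterm : ∀ i, derivative^[p - 1] (f (i + 1) ^ (p ^ (i + 1) - 1) * derivative (f (i + 1))) =
        -(f (i + 1) ^ (p ^ i - 1) * derivative (f (i + 1))) ^ p := by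
      intro i
      have h1 : p ^ (i + 1) - 1 = (p ^ i - 1) * p + (p - 1) := by
        have : 1 ≤ p ^ i := Nat.one_le_pow _ _ hp.pos
        obtain ⟨q, hq⟩ : ∃ q, p ^ i = q + 1 := ⟨p ^ i - 1, (Nat.sub_add_cancel this).symm⟩
        rw [pow_succ, hq, add_mul, one_mul, Nat.add_sub_cancel, Nat.add_sub_assoc hp.one_le]
      rw [h1, pow_add, pow_mul, mul_assoc, iterate_derivative_pow_mul,
        iterate_derivative_pow_pred_mul_derivative, mul_pow]
      ring
    have hsucc : ∀ i < t, derivative (f (i + 1)) ∈ I := by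
      refine ih (f := fun i => f (i + 1)) (fun i => hf _) (hroot _ ?_)
      have h2 := hiter (p - 1) _ h
      rw [iterate_map_add, pow_zero, Nat.sub_self, pow_zero, one_mul,
        ← Function.iterate_succ_apply, Nat.succ_eq_add_one, hp1,
        iterate_derivative_char (p := p) (f 0), add_zero, iterate_derivative_sum] at h2
      simp only [hterm, Finset.sum_neg_distrib] at h2
      rw [← neg_mem_iff, sum_pow_char]
      exact h2
    intro i hi
    cases i with
    | zero =>
      refine (add_mem_cancel_left (sum_mem fun i hi => ?_)).mp (by simpa using h)
      exact hmul _ (pow_mem (hf _) _) _ (hsucc i (Finset.mem_range.mp hi))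
    | succ i => exact hsucc i (by omega)

end Polynomial
/-! ### Purely inseparable extensions of degree `p` -/

section Inseparable

open Polynomial

variable {L : Type*} [Field L] [CharP L p]

theorem exists_aeval_eq_sum {F : Subfield L} {y : L} (hy : y ^ p ∈ F) (P : F[X]) :
    ∃ c : ℕ → L, (∀ j, c j ∈ F) ∧ aeval y P = ∑ j ∈ Finset.range p, c j * y ^ j ∧
      aeval y (derivative P) = ∑ j ∈ Finset.range p, j * c j * y ^ (j - 1) := by
  have hp := (Fact.out : p.Prime)
  set G : F[X] := X ^ p - C ⟨y ^ p, hy⟩ with hG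
  have hGm : G.Monic := monic_X_pow_sub_C _ hp.ne_zero
  have hG0 : aeval y G = 0 := by
    rw [hG, map_sub, map_pow, aeval_X, aeval_C]
    exact sub_self _
  have hG1 : derivative G = 0 := by
    rw [hG, derivative_sub, derivative_X_pow, derivative_C, CharP.cast_eq_zero, C_0]
    simp
  have hdeg : (P %ₘ G).natDegree < p := by
    have h := natDegree_modByMonic_lt P hGm (by
      intro h
      rw [h] at hG1
      have := congrArg natDegree (hG.symm.trans h)
      rw [natDegree_X_pow_sub_C, natDegree_one] at this
      exact hp.ne_zero this)
    rwa [hG, natDegree_X_pow_sub_C, ← hG] at h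
  have hQ := (P %ₘ G).as_sum_range_C_mul_X_pow' hdeg
  have hPQ := modByMonic_add_div P G
  refine ⟨fun j => (P %ₘ G).coeff j, fun j => ((P %ₘ G).coeff j).2, ?_, ?_⟩
  · conv_lhs => rw [← hPQ, map_add, map_mul, hG0, zero_mul, add_zero, hQ]
    simp only [map_sum, map_mul, map_pow, aeval_X, aeval_C]
    rfl
  · conv_lhs => rw [← hPQ, derivative_add, derivative_mul, hG1, zero_mul, zero_add, map_add,
      map_mul, hG0, zero_mul, add_zero, hQ]
    simp only [derivative_C_mul_X_pow, map_sum, map_mul, map_pow, map_natCast,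
      aeval_X, aeval_C]
    refine Finset.sum_congr rfl fun j _ => ?_
    rw [mul_comm (j : L)]
    rfl

theorem exists_aeval_eq_of_mem {F : Subfield L} {c : ℕ → L} (hc : ∀ j, c j ∈ F) (t : ℕ) (y : L) :
    ∃ P : F[X], aeval y P = ∑ j ∈ Finset.range t, c j * y ^ j := by
  refine ⟨∑ j ∈ Finset.range t, C ⟨c j, hc j⟩ * X ^ j, ?_⟩
  simp only [map_sum, map_mul, map_pow, aeval_X, aeval_C]
  rfl

theorem isIntegral_of_pow_mem {F : Subfield L} {y : L} (hy : y ^ p ∈ F) : IsIntegral F y := by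
  refine ⟨X ^ p - C ⟨y ^ p, hy⟩, monic_X_pow_sub_C _ (Fact.out : p.Prime).ne_zero, ?_⟩
  rw [eval₂_sub, eval₂_X_pow, eval₂_C]
  exact sub_self _

theorem mem_adjoin_iff_exists_sum {F : Subfield L} {y : L} (hy : y ^ p ∈ F) {x : L} :
    x ∈ IntermediateField.adjoin F {y} ↔
      ∃ c : ℕ → L, (∀ j, c j ∈ F) ∧ x = ∑ j ∈ Finset.range p, c j * y ^ j := by
  rw [← IntermediateField.mem_toSubalgebra,
    IntermediateField.adjoin_simple_toSubalgebra_of_isAlgebraic (isIntegral_of_pow_mem hy).isAlgebraic,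
    Algebra.adjoin_singleton_eq_range_aeval, AlgHom.mem_range]
  constructor
  · rintro ⟨P, rfl⟩
    obtain ⟨c, hc, h, -⟩ := exists_aeval_eq_sum hy P
    exact ⟨c, hc, h⟩
  · rintro ⟨c, hc, rfl⟩
    exact exists_aeval_eq_of_mem hc p y

theorem minpoly_eq_of_pow_mem {F : Subfield L} {y : L} (hy : y ^ p ∈ F) (hyF : y ∉ F) :
    minpoly F y = X ^ p - C ⟨y ^ p, hy⟩ := by
  have hp := (Fact.out : p.Prime)
  refine (minpoly.eq_of_irreducible_of_monic (X_pow_sub_C_irreducible_of_prime hp ?_) ?_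
    (monic_X_pow_sub_C _ hp.ne_zero)).symm
  · intro b hb
    have h : (b : L) ^ p = y ^ p := congrArg Subtype.val hb
    exact hyF (frobenius_inj L p h ▸ b.2)
  · rw [map_sub, map_pow, aeval_X, aeval_C]
    exact sub_self _

theorem natDegree_minpoly_of_pow_mem {F : Subfield L} {y : L} (hy : y ^ p ∈ F) (hyF : y ∉ F) :
    (minpoly F y).natDegree = p := by
  rw [minpoly_eq_of_pow_mem hy hyF, natDegree_X_pow_sub_C]

theorem eq_zero_of_sum_mul_pow_eq_zero {F : Subfield L} {y : L} (hy : y ^ p ∈ F) (hyF : y ∉ F)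
    {c : ℕ → L} (hc : ∀ j, c j ∈ F) (h : ∑ j ∈ Finset.range p, c j * y ^ j = 0) :
    ∀ j < p, c j = 0 := by
  intro j hj
  have hli := linearIndependent_pow (K := F) y
  rw [natDegree_minpoly_of_pow_mem hy hyF, Fintype.linearIndependent_iff] at hli
  have := hli (fun j => ⟨c j, hc j⟩) (by rw [Finset.sum_range] at h; exact h) ⟨j, hj⟩
  exact congrArg Subtype.val this

theorem exists_eq_sum_of_eq_sum {F : Subfield L} {y b : L} (hy : y ^ p ∈ F) (hyF : y ∉ F)
    (hb : b ^ p ∈ F) (hbF : b ∉ F) {c : ℕ → L} (hc : ∀ j, c j ∈ F)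
    (h : b = ∑ j ∈ Finset.range p, c j * y ^ j) :
    ∃ c : ℕ → L, (∀ j, c j ∈ F) ∧ y = ∑ j ∈ Finset.range p, c j * b ^ j := by
  rw [← mem_adjoin_iff_exists_sum hb]
  have hle : IntermediateField.adjoin F {b} ≤ IntermediateField.adjoin F {y} := by
    rw [IntermediateField.adjoin_simple_le_iff, mem_adjoin_iff_exists_sum hy]
    exact ⟨c, hc, h⟩
  have := IntermediateField.adjoin.finiteDimensional (isIntegral_of_pow_mem hy)
  rw [IntermediateField.eq_of_le_of_finrank_eq hle]
  · exact IntermediateField.mem_adjoin_simple_self F y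
  · rw [IntermediateField.adjoin.finrank (isIntegral_of_pow_mem hy),
      IntermediateField.adjoin.finrank (isIntegral_of_pow_mem hb),
      natDegree_minpoly_of_pow_mem hy hyF, natDegree_minpoly_of_pow_mem hb hbF]

theorem exists_subfield_mem_iff {F : Subfield L} {y : L} (hy : y ^ p ∈ F) :
    ∃ F' : Subfield L, F ≤ F' ∧ y ∈ F' ∧ ∀ x, x ∈ F' ↔
      ∃ c : ℕ → L, (∀ j, c j ∈ F) ∧ x = ∑ j ∈ Finset.range p, c j * y ^ j :=
  ⟨(IntermediateField.adjoin F {y}).toSubfield,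
    fun x hx => (IntermediateField.adjoin F {y}).algebraMap_mem ⟨x, hx⟩,
    IntermediateField.mem_adjoin_simple_self F y, fun _ => mem_adjoin_iff_exists_sum hy⟩

theorem mem_Kp_iff {x : K} : x ∈ Kp p K ↔ ∃ y, y ^ p = x := by
  refine ⟨fun h => ?_, fun ⟨y, hy⟩ => hy ▸ pow_p_mem_Kp y⟩
  have hle : Kp p K ≤ (frobenius K p).fieldRange :=
    Subfield.closure_le.mpr fun x ⟨y, hy⟩ => ⟨y, hy⟩
  exact hle h

theorem exists_maximal_subfield {q : L → Prop} {F₀ : Subfield L} (h₀ : ∀ x ∈ F₀, q x) :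
    ∃ F : Subfield L, F₀ ≤ F ∧ (∀ x ∈ F, q x) ∧
      ∀ F' : Subfield L, F ≤ F' → (∀ x ∈ F', q x) → F' ≤ F := by
  obtain ⟨F, hF, hmax⟩ := zorn_le_nonempty₀ {F : Subfield L | ∀ x ∈ F, q x} (fun c hc hch F hF => by
    refine ⟨sSup c, fun x hx => ?_, fun F hF => le_sSup hF⟩
    rw [Subfield.mem_sSup_of_directedOn ⟨F, hF⟩ hch.directedOn] at hx
    obtain ⟨F, hF, hx⟩ := hx
    exact hc hF x hx) F₀ h₀
  exact ⟨F, hF, hmax.1, fun F' hle hF' => hmax.2 hF' hle⟩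

end Inseparable
/-! ### Residue fields -/

section Residue

open IsLocalRing

variable (v) in
/-- The valuation ring of `K`. -/
def integerRing : ValuationSubring K where
  carrier := {x | 0 ≤ v x}
  mul_mem' hx hy := by
    change 0 ≤ v (_ * _)
    rw [AddValuation.map_mul]
    exact add_nonneg hx hy
  one_mem' := by simp
  add_mem' hx hy := v.map_le_add hx hy
  zero_mem' := by simp
  neg_mem' hx := by
    change 0 ≤ v (-_)
    rw [AddValuation.map_neg]
    exact hx
  mem_or_inv_mem' x := by
    rcases eq_or_ne x 0 with rfl | hx
    · simp
    obtain ⟨k, hk⟩ := exists_map_eq_coe (v := v) hx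
    have hk' : v x⁻¹ = (-k : ℤ) := by
      rw [AddValuation.map_inv, hk]
      rfl
    change 0 ≤ v x ∨ 0 ≤ v x⁻¹
    rw [hk, hk']
    norm_cast
    omega

theorem mem_integerRing {x : K} : x ∈ integerRing v ↔ 0 ≤ v x := Iff.rfl

theorem residue_eq_zero_iff_one_le {x : integerRing v} :
    residue (integerRing v) x = 0 ↔ 1 ≤ v (x : K) := by
  have hx := mem_integerRing.mp x.2
  rw [residue_eq_zero_iff, mem_maximalIdeal, mem_nonunits_iff]
  rcases eq_or_ne (x : K) 0 with h0 | h0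
  · have : x = 0 := Subtype.ext h0
    simp [this]
  obtain ⟨k, hk⟩ := exists_map_eq_coe (v := v) h0
  have hk' : v (x : K)⁻¹ = (-k : ℤ) := by
    rw [AddValuation.map_inv, hk]
    rfl
  rw [hk] at hx ⊢
  norm_cast at hx ⊢
  constructor
  · intro h
    by_contra hk0
    refine h (IsUnit.of_mul_eq_one ⟨(x : K)⁻¹, mem_integerRing.mpr ?_⟩ (Subtype.ext ?_))
    · rw [hk']
      norm_cast
      omega
    · exact mul_inv_cancel₀ h0
  · intro h hu
    obtain ⟨y, hy⟩ := hu.exists_right_inv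
    have h1 : v (x : K) + v (y : K) = 0 := by
      rw [← AddValuation.map_mul, ← AddValuation.map_one v]
      exact congrArg v (congrArg Subtype.val hy)
    have h2 := mem_integerRing.mp y.2
    have h3 : v (x : K) ≤ v (x : K) + v (y : K) := le_add_of_nonneg_right h2
    rw [h1, hk] at h3
    norm_cast at h3
    omega

variable (v) in
/-- The residue field of a subfield of `K`. -/
def residueSubfield (F : Subfield K) : Subfield (ResidueField (integerRing v)) where
  carrier := {r | ∃ x : integerRing v, (x : K) ∈ F ∧ residue _ x = r}
  mul_mem' := by
    rintro _ _ ⟨x, hx, rfl⟩ ⟨y, hy, rfl⟩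
    exact ⟨x * y, mul_mem hx hy, map_mul _ _ _⟩
  one_mem' := ⟨1, one_mem F, map_one _⟩
  add_mem' := by
    rintro _ _ ⟨x, hx, rfl⟩ ⟨y, hy, rfl⟩
    exact ⟨x + y, add_mem hx hy, map_add _ _ _⟩
  zero_mem' := ⟨0, zero_mem F, map_zero _⟩
  neg_mem' := by
    rintro _ ⟨x, hx, rfl⟩
    exact ⟨-x, neg_mem hx, map_neg _ _⟩
  inv_mem' := by
    rintro _ ⟨x, hx, rfl⟩
    rcases eq_or_ne (residue _ x) 0 with h0 | h0
    · exact ⟨0, zero_mem F, by rw [h0, inv_zero, map_zero]⟩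
    obtain ⟨y, hy⟩ := ((residue_ne_zero_iff_isUnit x).mp h0).exists_right_inv
    refine ⟨y, ?_, eq_inv_of_mul_eq_one_right (by rw [← map_mul, hy, map_one])⟩
    rw [eq_inv_of_mul_eq_one_right (a := (x : K)) (b := y) (congrArg Subtype.val hy)]
    exact inv_mem hx

theorem mem_residueSubfield {F : Subfield K} {r : ResidueField (integerRing v)} :
    r ∈ residueSubfield v F ↔ ∃ x : integerRing v, (x : K) ∈ F ∧ residue _ x = r := Iff.rfl

instance charP_residueField : CharP (ResidueField (integerRing v)) p := by
  have : CharP (integerRing v) p :=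
    (algebraMap (integerRing v) K).charP Subtype.val_injective p
  refine (CharP.charP_iff_prime_eq_zero (Fact.out : p.Prime)).mpr ?_
  rw [← map_natCast (residue (integerRing v)), CharP.cast_eq_zero, map_zero]

theorem residue_eq_iff_one_le {x y : integerRing v} :
    residue _ x = residue _ y ↔ 1 ≤ v ((x : K) - y) := by
  rw [← sub_eq_zero, ← map_sub, residue_eq_zero_iff_one_le]
  rfl

theorem residue_mem_residueSubfield_iff {F : Subfield K} {y : integerRing v} :
    residue _ y ∈ residueSubfield v F ↔ ∃ a ∈ F, 1 ≤ v ((y : K) - a) := by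
  rw [mem_residueSubfield]
  constructor
  · rintro ⟨x, hx, h⟩
    exact ⟨x, hx, residue_eq_iff_one_le.mp h.symm⟩
  · rintro ⟨a, ha, h⟩
    have ha0 : 0 ≤ v a := by
      simpa using v.map_le_sub (mem_integerRing.mp y.2) (zero_le_one.trans h)
    exact ⟨⟨a, ha0⟩, ha, (residue_eq_iff_one_le.mpr h).symm⟩

theorem residue_sum_mul_pow (c : ℕ → integerRing v) (y : integerRing v) :
    residue _ (∑ j ∈ Finset.range p, c j * y ^ j) =
      ∑ j ∈ Finset.range p, residue _ (c j) * residue _ y ^ j := by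
  simp only [map_sum, map_mul, map_pow]

/-- If the residue class of `y` is not that of an element of `F`, then `1, y, …, y ^ (p - 1)` is
an orthonormal family over `F`. -/
theorem exists_map_sum_mul_pow_eq {F : Subfield K} {y : K} (hy0 : 0 ≤ v y) (hy : y ^ p ∈ F)
    (hF : ∀ a ∈ F, ¬ 1 ≤ v (y - a)) {c : ℕ → K} (hc : ∀ j, c j ∈ F) :
    ∃ i < p, v (∑ j ∈ Finset.range p, c j * y ^ j) = v (c i) ∧ ∀ j < p, v (c i) ≤ v (c j) := by
  have hp := (Fact.out : p.Prime)
  obtain ⟨i, hi, hmin⟩ := Finset.exists_min_image (Finset.range p) (fun j => v (c j))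
    ⟨0, Finset.mem_range.mpr hp.pos⟩
  simp only [Finset.mem_range] at hi hmin
  refine ⟨i, hi, ?_, hmin⟩
  rcases eq_or_ne (c i) 0 with h0 | h0
  · have hz : ∀ j ∈ Finset.range p, c j * y ^ j = 0 := fun j hj => by
      have := hmin j (Finset.mem_range.mp hj)
      rw [h0, AddValuation.map_zero, top_le_iff, AddValuation.top_iff] at this
      rw [this, zero_mul]
    rw [Finset.sum_eq_zero hz, h0]
  obtain ⟨l, hl⟩ := exists_map_eq_coe (v := v) h0
  have hli : v (c i)⁻¹ = (-l : ℤ) := by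
    rw [AddValuation.map_inv, hl]
    rfl
  let e : ℕ → integerRing v := fun j =>
    if hj : j < p then ⟨(c i)⁻¹ * c j, by
      rw [mem_integerRing, AddValuation.map_mul, hli]
      calc (0 : WithTop ℤ) = ((-l : ℤ) : WithTop ℤ) + (l : ℤ) := by norm_cast; simp
        _ ≤ _ := by gcongr; exact hl ▸ hmin j hj⟩ else 0
  have he : ∀ j < p, ((e j : integerRing v) : K) = (c i)⁻¹ * c j := fun j hj => by
    simp only [e, dif_pos hj]
  have heF : ∀ j, ((e j : integerRing v) : K) ∈ F := fun j => by
    by_cases hj : j < p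
    · rw [he j hj]
      exact mul_mem (inv_mem (hc i)) (hc j)
    · simp only [e, dif_neg hj]
      exact zero_mem F
  set S : integerRing v := ∑ j ∈ Finset.range p, e j * ⟨y, hy0⟩ ^ j with hS
  have hSc : ∑ j ∈ Finset.range p, c j * y ^ j = c i * (S : K) := by
    rw [hS]
    push_cast
    rw [Finset.mul_sum]
    refine Finset.sum_congr rfl fun j hj => ?_
    rw [he j (Finset.mem_range.mp hj), ← mul_assoc, ← mul_assoc, mul_inv_cancel₀ h0, one_mul]
  have hS0 : residue _ S ≠ 0 := by
    intro h
    rw [hS, residue_sum_mul_pow] at h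
    have hy1 : residue (integerRing v) ⟨y, hy0⟩ ∉ residueSubfield v F := by
      rw [residue_mem_residueSubfield_iff]
      rintro ⟨a, ha, h⟩
      exact hF a ha h
    have hyp : residue (integerRing v) ⟨y, hy0⟩ ^ p ∈ residueSubfield v F :=
      ⟨⟨y, hy0⟩ ^ p, hy, map_pow _ _ _⟩
    have := eq_zero_of_sum_mul_pow_eq_zero hyp hy1
      (fun j => ⟨e j, heF j, rfl⟩ : ∀ j, residue _ (e j) ∈ residueSubfield v F) h i hi
    rw [residue_eq_zero_iff_one_le, he i hi, inv_mul_cancel₀ h0, AddValuation.map_one] at this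
    exact absurd this (by norm_num)
  have hvS : v (S : K) = 0 := by
    rw [Ne, residue_eq_zero_iff_one_le] at hS0
    have h0 := mem_integerRing.mp S.2
    have hS1 : (S : K) ≠ 0 := fun h => hS0 (by simp [h])
    obtain ⟨k, hk⟩ := exists_map_eq_coe (v := v) hS1
    rw [hk] at hS0 h0 ⊢
    norm_cast at hS0 h0 ⊢
    omega
  rw [hSc, AddValuation.map_mul, hvS, add_zero]

/-- A criterion for the residue field extension of `F(b) / F` to contain the class of `y`. -/
theorem exists_one_le_sub_sum {F : Subfield K} {y b : K} (hy0 : 0 ≤ v y) (hy : y ^ p ∈ F)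
    (hyF : ∀ a ∈ F, ¬ 1 ≤ v (y - a)) (hb0 : 0 ≤ v b) (hb : b ^ p ∈ F)
    (hbF : ∀ a ∈ F, ¬ 1 ≤ v (b - a)) {c : ℕ → K} (hc : ∀ j, c j ∈ F)
    (h : 1 ≤ v (b - ∑ j ∈ Finset.range p, c j * y ^ j)) :
    ∃ c : ℕ → K, (∀ j, c j ∈ F) ∧ 1 ≤ v (y - ∑ j ∈ Finset.range p, c j * b ^ j) := by
  have hx0 : 0 ≤ v (∑ j ∈ Finset.range p, c j * y ^ j) := by
    simpa using v.map_le_sub hb0 (zero_le_one.trans h)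
  obtain ⟨i, -, hi, hmin⟩ := exists_map_sum_mul_pow_eq hy0 hy hyF hc
  rw [hi] at hx0
  let e : ℕ → integerRing v := fun j =>
    if hj : j < p then ⟨c j, hx0.trans (hmin j hj)⟩ else 0
  have he : ∀ j < p, ((e j : integerRing v) : K) = c j := fun j hj => by
    simp only [e, dif_pos hj]
  have heF : ∀ j, ((e j : integerRing v) : K) ∈ F := fun j => by
    by_cases hj : j < p
    · rw [he j hj]
      exact hc j
    · simp only [e, dif_neg hj]
      exact zero_mem F
  have hnot : ∀ {z : K} (hz0 : 0 ≤ v z), (∀ a ∈ F, ¬ 1 ≤ v (z - a)) →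
      residue (integerRing v) ⟨z, hz0⟩ ∉ residueSubfield v F := by
    intro z hz0 hz
    rw [residue_mem_residueSubfield_iff]
    rintro ⟨a, ha, h⟩
    exact hz a ha h
  obtain ⟨f, hf, hfy⟩ := exists_eq_sum_of_eq_sum (p := p) (F := residueSubfield v F)
    (y := residue (integerRing v) ⟨y, hy0⟩) (b := residue (integerRing v) ⟨b, hb0⟩)
    ⟨⟨y, hy0⟩ ^ p, hy, map_pow _ _ _⟩ (hnot hy0 hyF) ⟨⟨b, hb0⟩ ^ p, hb, map_pow _ _ _⟩
    (hnot hb0 hbF) (c := fun j => residue _ (e j)) (fun j => ⟨e j, heF j, rfl⟩) (by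
      rw [← residue_sum_mul_pow, residue_eq_iff_one_le]
      convert h using 3
      push_cast
      exact Finset.sum_congr rfl fun j hj => by rw [he j (Finset.mem_range.mp hj)])
  choose g hgF hg using hf
  refine ⟨fun j => g j, hgF, ?_⟩
  simp only [← hg] at hfy
  rw [← residue_sum_mul_pow, residue_eq_iff_one_le] at hfy
  convert hfy using 3
  push_cast
  rfl

end Residue
/-! ### Dense subfields generated by one element over a subfield -/

section Dense

open Polynomial

theorem zero_le_map_aeval_derivative {F : Subfield K} {z : K} (hz0 : 0 ≤ v z) (hz : z ^ p ∈ F)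
    (hint : ∀ c : ℕ → K, (∀ j, c j ∈ F) → 0 ≤ v (∑ j ∈ Finset.range p, c j * z ^ j) →
      ∀ j < p, 0 ≤ v (c j))
    (P : F[X]) (hP : 0 ≤ v (aeval z P)) : 0 ≤ v (aeval z (derivative P)) := by
  obtain ⟨c, hc, h1, h2⟩ := exists_aeval_eq_sum hz P
  rw [h1] at hP
  rw [h2]
  refine v.map_le_sum fun j hj => ?_
  have hj0 := hint c hc hP j (Finset.mem_range.mp hj)
  rw [← mem_integerRing] at hj0 hz0 ⊢
  exact mul_mem (mul_mem (natCast_mem _ j) hj0) (pow_mem hz0 _)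

theorem exists_le_sub_aeval {π : K} (hπ : v π = 1) {F : Subfield K} {z : K} (hz : z ^ p ∈ F)
    (hπF : ∃ c : ℕ → K, (∀ j, c j ∈ F) ∧ π = ∑ j ∈ Finset.range p, c j * z ^ j)
    (hden : ∀ y, 0 ≤ v y → ∃ c : ℕ → K, (∀ j, c j ∈ F) ∧
      1 ≤ v (y - ∑ j ∈ Finset.range p, c j * z ^ j)) (x : K) (N : ℤ) :
    ∃ P : F[X], (N : WithTop ℤ) ≤ v (x - aeval z P) := by
  obtain ⟨F', -, -, hF'⟩ := exists_subfield_mem_iff hz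
  rw [← hF'] at hπF
  suffices ∃ r ∈ F', (N : WithTop ℤ) ≤ v (x - r) by
    obtain ⟨r, hr, h⟩ := this
    obtain ⟨c, hc, rfl⟩ := (hF' r).mp hr
    obtain ⟨P, hP⟩ := exists_aeval_eq_of_mem hc p z
    exact ⟨P, hP ▸ h⟩
  rcases eq_or_ne x 0 with rfl | hx
  · exact ⟨0, zero_mem _, by simp⟩
  obtain ⟨k, hk⟩ := exists_map_eq_coe (v := v) hx
  have key : ∀ n : ℕ, ∃ r ∈ F', ((k + n : ℤ) : WithTop ℤ) ≤ v (x - r) := by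
    intro n
    induction n with
    | zero => exact ⟨0, zero_mem _, by simp [hk]⟩
    | succ n ih =>
      obtain ⟨r, hr, h⟩ := ih
      obtain ⟨u, hu, hxr⟩ := (le_map_iff_exists hπ).mp h
      obtain ⟨c, hc, hcu⟩ := hden u hu
      obtain ⟨s, hs⟩ : ∃ s, s = ∑ j ∈ Finset.range p, c j * z ^ j := ⟨_, rfl⟩
      rw [← hs] at hcu
      refine ⟨r + π ^ (k + n : ℤ) * s, add_mem hr (mul_mem (zpow_mem hπF _)
        ((hF' s).mpr ⟨c, hc, hs⟩)), ?_⟩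
      rw [← sub_sub, hxr, ← mul_sub, AddValuation.map_mul, map_uniformizer_zpow hπ]
      calc ((k + (n + 1 : ℕ) : ℤ) : WithTop ℤ) = ((k + n : ℤ) : WithTop ℤ) + 1 := by
            push_cast
            rw [add_assoc]
        _ ≤ _ := by gcongr
  obtain ⟨r, hr, h⟩ := key (N - k).toNat
  exact ⟨r, hr, (WithTop.coe_le_coe.mpr (by omega)).trans h⟩

/-- If `F` has ramification index divisible by `p`, then the powers `1, π, …, π ^ (p - 1)` are
orthogonal over `F`. -/
theorem zero_le_map_coeff_of_dvd {π : K} (hπ : v π = 1) {F : Subfield K}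
    (hF : ∀ x ∈ F, ∀ k : ℤ, v x = k → (p : ℤ) ∣ k) {c : ℕ → K} (hc : ∀ j, c j ∈ F)
    (h : 0 ≤ v (∑ j ∈ Finset.range p, c j * π ^ j)) : ∀ j < p, 0 ≤ v (c j) := by
  have hp := (Fact.out : p.Prime)
  have hterm : ∀ j, ∀ k : ℤ, v (c j) = k → v (c j * π ^ j) = (k + j : ℤ) := fun j k hk => by
    rw [AddValuation.map_mul, hk, ← zpow_natCast, map_uniformizer_zpow hπ]
    rfl
  obtain ⟨i, hi, hmin⟩ := Finset.exists_min_image (Finset.range p) (fun j => v (c j * π ^ j))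
    ⟨0, Finset.mem_range.mpr hp.pos⟩
  have hmain : 0 ≤ v (c i * π ^ i) := by
    rcases eq_or_ne (c i) 0 with h0 | h0
    · simp [h0]
    obtain ⟨k, hk⟩ := exists_map_eq_coe (v := v) h0
    refine h.trans_eq ?_
    rw [← Finset.add_sum_erase _ _ hi]
    refine v.map_add_eq_of_lt_left (v.map_lt_sum (by rw [hterm i k hk]; exact WithTop.coe_ne_top)
      fun j hj => ?_)
    obtain ⟨hji, hj⟩ := Finset.mem_erase.mp hj
    refine lt_of_le_of_ne (hmin j hj) fun heq => ?_
    rcases eq_or_ne (c j) 0 with hj0 | hj0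
    · rw [hj0, zero_mul, AddValuation.map_zero, hterm i k hk] at heq
      exact WithTop.coe_ne_top heq
    obtain ⟨l, hl⟩ := exists_map_eq_coe (v := v) hj0
    rw [hterm i k hk, hterm j l hl, WithTop.coe_inj] at heq
    obtain ⟨a, ha⟩ := hF _ (hc i) k hk
    obtain ⟨b, hb⟩ := hF _ (hc j) l hl
    have hdvd : (p : ℤ) ∣ (j : ℤ) - i := ⟨a - b, by rw [mul_sub]; omega⟩
    rw [Finset.mem_range] at hi hj
    have := Int.eq_zero_of_abs_lt_dvd hdvd (by rw [abs_lt]; omega)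
    omega
  intro j hj
  rcases eq_or_ne (c j) 0 with hj0 | hj0
  · simp [hj0]
  obtain ⟨l, hl⟩ := exists_map_eq_coe (v := v) hj0
  have h0 := hmain.trans (hmin j (Finset.mem_range.mpr hj))
  simp only [hterm j l hl] at h0
  obtain ⟨b, rfl⟩ := hF _ (hc j) l hl
  rw [hl]
  norm_cast at h0 ⊢
  have hb : 0 ≤ b := by
    by_contra hb
    have : (p : ℤ) * b ≤ p * (-1) := mul_le_mul_of_nonneg_left (by omega) (by positivity)
    omega
  positivity

theorem dvd_of_mem_Kp {x : K} (hx : x ∈ Kp p K) {k : ℤ} (hk : v x = k) : (p : ℤ) ∣ k := by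
  obtain ⟨y, rfl⟩ := mem_Kp_iff.mp hx
  have hy : y ≠ 0 := by
    rintro rfl
    rw [zero_pow (Fact.out : p.Prime).ne_zero, AddValuation.map_zero] at hk
    exact WithTop.top_ne_coe hk
  obtain ⟨l, hl⟩ := exists_map_eq_coe (v := v) hy
  rw [AddValuation.map_pow, hl, nsmul_coe_int, WithTop.coe_inj] at hk
  exact ⟨l, hk.symm⟩

theorem exists_subfield_uniformizer {π : K} (hπ : v π = 1) : ∃ F : Subfield K, Kp p K ≤ F ∧
    (∀ P : F[X], 0 ≤ v (aeval π P) → 0 ≤ v (aeval π (derivative P))) ∧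
    ∀ (x : K) (N : ℤ), ∃ P : F[X], (N : WithTop ℤ) ≤ v (x - aeval π P) := by
  obtain ⟨F, hle, hF, hmax⟩ := exists_maximal_subfield
    (q := fun x : K => ∀ k : ℤ, v x = k → (p : ℤ) ∣ k) (F₀ := Kp p K)
    fun x hx k hk => dvd_of_mem_Kp hx hk
  have hmem : ∀ y : K, y ^ p ∈ F := fun y => hle (pow_p_mem_Kp y)
  refine ⟨F, hle, zero_le_map_aeval_derivative (by rw [hπ]; exact zero_le_one) (hmem π)
    fun c hc => zero_le_map_coeff_of_dvd hπ hF hc, exists_le_sub_aeval hπ (hmem π) ?_ ?_⟩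
  · exact ⟨fun j => if j = 1 then 1 else 0, fun j => by dsimp only; split_ifs <;> simp,
      by simp [(Fact.out : p.Prime).one_lt]⟩
  · intro y hy
    obtain ⟨a, ha, h⟩ : ∃ a ∈ F, 1 ≤ v (y - a) := by
      by_contra! hne
      obtain ⟨F', hFF', hyF', hF'⟩ := exists_subfield_mem_iff (hmem y)
      have := hmax F' hFF' (fun x hx k hk => by
        obtain ⟨c, hc, rfl⟩ := (hF' x).mp hx
        obtain ⟨i, -, hi, -⟩ := exists_map_sum_mul_pow_eq hy (hmem y)
          (fun a ha => (hne a ha).not_ge) hc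
        exact hF _ (hc i) k (hi ▸ hk)) hyF'
      have := hne y this
      simp at this
    exact ⟨fun j => if j = 0 then a else 0, fun j => by dsimp only; split_ifs <;> simp [ha],
      by simpa [(Fact.out : p.Prime).pos] using h⟩

theorem exists_subfield_of_forall_pow {π b : K} (hπ : v π = 1) (hb0 : 0 ≤ v b)
    (hb : ∀ w, ¬ 1 ≤ v (b - w ^ p)) : ∃ F : Subfield K, Kp p K ≤ F ∧ π ∈ F ∧
    (∀ P : F[X], 0 ≤ v (aeval b P) → 0 ≤ v (aeval b (derivative P))) ∧
    ∀ (x : K) (N : ℤ), ∃ P : F[X], (N : WithTop ℤ) ≤ v (x - aeval b P) := by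
  have hp := (Fact.out : p.Prime)
  obtain ⟨F₀, hle₀, hπ₀, hF₀⟩ := exists_subfield_mem_iff (p := p) (pow_p_mem_Kp π)
  obtain ⟨F, hle, hF, hmax⟩ := exists_maximal_subfield (q := fun x : K => ¬ 1 ≤ v (b - x))
    (F₀ := F₀) fun x hx h => by
      obtain ⟨c, hc, rfl⟩ := (hF₀ x).mp hx
      have hx0 : 0 ≤ v (∑ j ∈ Finset.range p, c j * π ^ j) := by
        simpa using v.map_le_sub hb0 (zero_le_one.trans h)
      have hc0 := zero_le_map_coeff_of_dvd hπ (F := Kp p K)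
        (fun x hx k hk => dvd_of_mem_Kp hx hk) hc hx0
      obtain ⟨w, hw⟩ := mem_Kp_iff.mp (hc 0)
      refine hb w ?_
      rw [← Finset.add_sum_erase _ _ (Finset.mem_range.mpr hp.pos), pow_zero, mul_one, ← hw,
        ← sub_sub] at h
      have h2 : 1 ≤ v (∑ j ∈ (Finset.range p).erase 0, c j * π ^ j) := by
        refine v.map_le_sum fun j hj => ?_
        obtain ⟨hj0, hj⟩ := Finset.mem_erase.mp hj
        rw [AddValuation.map_mul, AddValuation.map_pow, hπ]
        refine le_add_of_nonneg_of_le (hc0 j (Finset.mem_range.mp hj)) ?_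
        simpa using (show (1 : WithTop ℤ) ≤ j by
          exact_mod_cast Nat.one_le_iff_ne_zero.mpr hj0)
      simpa using v.map_le_add h h2
  have hle' := hle₀.trans hle
  have hmem : ∀ y : K, y ^ p ∈ F := fun y => hle' (pow_p_mem_Kp y)
  refine ⟨F, hle', hle hπ₀, zero_le_map_aeval_derivative hb0 (hmem b) fun c hc h j hj => ?_,
    exists_le_sub_aeval hπ (hmem b) ?_ fun y hy => ?_⟩
  · obtain ⟨i, -, hi, hmin⟩ := exists_map_sum_mul_pow_eq hb0 (hmem b) hF hc
    exact (hi ▸ h).trans (hmin j hj)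
  · exact ⟨fun j => if j = 0 then π else 0, fun j => by dsimp only; split_ifs <;> simp [hle hπ₀],
      by simp [hp.pos]⟩
  · by_cases hne : ∃ a ∈ F, 1 ≤ v (y - a)
    · obtain ⟨a, ha, h⟩ := hne
      exact ⟨fun j => if j = 0 then a else 0, fun j => by dsimp only; split_ifs <;> simp [ha],
        by simpa [hp.pos] using h⟩
    have hyF : ∀ a ∈ F, ¬ 1 ≤ v (y - a) := fun a ha h => hne ⟨a, ha, h⟩
    obtain ⟨F', hFF', hyF', hF'⟩ := exists_subfield_mem_iff (hmem y)
    obtain ⟨x, hx, hxb⟩ : ∃ x ∈ F', 1 ≤ v (b - x) := by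
      by_contra! hlt
      have := hmax F' hFF' (fun x hx => (hlt x hx).not_ge) hyF'
      exact hyF y this (by simp)
    obtain ⟨c, hc, rfl⟩ := (hF' x).mp hx
    exact exists_one_le_sub_sum hy (hmem y) hyF hb0 (hmem b) hF hc hxb

theorem le_map_of_smul_D_uniformizer_mem {π : K} (hπ : v π = 1) {n : ℤ} {u : K}
    (h : u • KaehlerDifferential.D (Kp p K) K π ∈ filOmega' p K v π n) :
    ((-n : ℤ) : WithTop ℤ) ≤ v u := by
  obtain ⟨F, hF, h1, h2⟩ := exists_subfield_uniformizer (p := p) hπ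
  have h' : ∑ i ∈ ({()} : Finset Unit), (fun _ : Unit => u) i •
      KaehlerDifferential.D (Kp p K) K ((fun _ : Unit => π) i) ∈ filOmega' p K v π n := by
    simpa using h
  obtain ⟨P, hP, hPn⟩ := exists_polynomial_of_sum_mem hπ hF h1 h2 h' (p * 1)
  have h3 : ((p * 1 : ℤ) : WithTop ℤ) ≤ v (aeval π (X - P ())) := by
    rw [map_sub, aeval_X]
    exact hP ()
  have h4 := le_map_aeval_derivative hπ hF h1 h3
  rw [derivative_sub, derivative_X, map_sub, map_one] at h4
  have h5 : v (aeval π (derivative (P ()))) = 0 := by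
    rw [← AddValuation.map_one v, AddValuation.map_sub_swap] at *
    refine AddValuation.map_eq_of_lt_sub _ ?_
    rw [AddValuation.map_one v]
    refine lt_of_lt_of_le ?_ h4
    exact_mod_cast (by simpa using (Fact.out : p.Prime).pos)
  simpa [h5] using hPn

theorem exists_sub_pow_of_sum_mem {π : K} (hπ : v π = 1) {t : ℕ} {u : ℕ → K}
    (hu : ∀ i, 0 ≤ v (u i))
    (h : ∑ i ∈ Finset.range t, u i ^ (p ^ i - 1) • KaehlerDifferential.D (Kp p K) K (u i) ∈
      filOmega' p K v π (-1)) :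
    ∀ i < t, ∃ w, 0 ≤ v w ∧ 1 ≤ v (u i - w ^ p) := by
  have hp := (Fact.out : p.Prime)
  intro i hi
  by_contra! hne
  set b := u i with hb
  have hb0 : 0 ≤ v b := hu i
  obtain ⟨F, hF, hπF, h1, h2⟩ := exists_subfield_of_forall_pow (p := p) hπ hb0 (fun w hw => by
    refine (hne w ?_).not_ge hw
    have : 0 ≤ v (w ^ p) := by simpa using v.map_le_sub hb0 (zero_le_one.trans hw)
    rw [AddValuation.map_pow] at this
    exact (nsmul_nonneg_iff hp.ne_zero).mp this)
  obtain ⟨P, hP, hPn⟩ := exists_polynomial_of_sum_mem hπ hF h1 h2 h 1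
  let R : Subring F[X] := (integerRing v).toSubring.comap (aeval b : F[X] →ₐ[F] K).toRingHom
  let I : AddSubgroup F[X] :=
    { carrier := {P | 1 ≤ v (aeval b P)}
      add_mem' := fun {P Q} hP hQ => by
        change 1 ≤ v (aeval b (P + Q))
        rw [map_add]
        exact v.map_le_add hP hQ
      zero_mem' := by simp
      neg_mem' := fun {P} hP => by
        change 1 ≤ v (aeval b (-P))
        rwa [map_neg, AddValuation.map_neg] }
  have hDI : ∀ Q ∈ I, derivative Q ∈ I := by
    intro Q hQ
    have hc : ∀ Q : F[X], 1 ≤ v (aeval b Q) ↔ 0 ≤ v (aeval b (C ⟨π, hπF⟩⁻¹ * Q)) := by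
      intro Q
      have : aeval b (C ⟨π, hπF⟩⁻¹ * Q) = π⁻¹ * aeval b Q := by
        rw [map_mul, aeval_C]
        rfl
      rw [this]
      rcases eq_or_ne (aeval b Q) 0 with h0 | h0
      · simp [h0]
      obtain ⟨k, hk⟩ := exists_map_eq_coe (v := v) h0
      rw [AddValuation.map_mul, hk, ← zpow_neg_one, map_uniformizer_zpow hπ]
      norm_cast
      omega
    have := h1 _ ((hc Q).mp hQ)
    rw [derivative_C_mul] at this
    exact (hc _).mpr this
  have hPR : ∀ j, P j ∈ R := fun j => by
    have := v.map_le_sub (hu j) (zero_le_one.trans (hP j))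
    rwa [sub_sub_cancel] at this
  have hdR : ∀ j, derivative (P j) ∈ R := fun j => h1 _ (hPR j)
  have hmul : ∀ Q ∈ R, ∀ S ∈ I, Q * S ∈ I := by
    intro Q hQ S hS
    change 1 ≤ v (aeval b (Q * S))
    rw [map_mul, AddValuation.map_mul]
    exact le_add_of_nonneg_of_le hQ hS
  have hroot : ∀ Q : F[X], Q ^ p ∈ I → Q ∈ I := by
    intro Q hQ
    change 1 ≤ v (aeval b (Q ^ p)) at hQ
    change 1 ≤ v (aeval b Q)
    rw [map_pow, AddValuation.map_pow] at hQ
    have hQ' := (coe_le_nsmul_map_iff hp.ne_zero (n := 1)).mp hQ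
    rw [← one_nsmul (v _)]
    refine (coe_le_nsmul_map_iff one_ne_zero (n := 1)).mpr fun k hk => ?_
    have h3 : 0 < k := pos_of_mul_pos_right (zero_lt_one.trans_le (hQ' k hk)) (by positivity)
    simpa using Int.add_one_le_of_lt h3
  have hsum : ∑ j ∈ Finset.range t, P j ^ (p ^ j - 1) * derivative (P j) ∈ I := by
    change 1 ≤ v (aeval b _)
    have hdiff : 1 ≤ v (∑ j ∈ Finset.range t,
        (u j ^ (p ^ j - 1) - aeval b (P j) ^ (p ^ j - 1)) * aeval b (derivative (P j))) := by
      refine v.map_le_sum fun j _ => ?_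
      rw [AddValuation.map_mul]
      refine le_add_of_le_of_nonneg ?_ (hdR j)
      let x : integerRing v := ⟨u j, hu j⟩
      let y : integerRing v := ⟨aeval b (P j), hPR j⟩
      have hxy : IsLocalRing.residue _ x = IsLocalRing.residue _ y :=
        residue_eq_iff_one_le.mpr (hP j)
      exact residue_eq_iff_one_le (x := x ^ (p ^ j - 1)) (y := y ^ (p ^ j - 1)).mp
        (by rw [map_pow, map_pow, hxy])
    have := v.map_le_sub hPn hdiff
    rw [← Finset.sum_sub_distrib] at this
    simp only [sub_mul, sub_sub_cancel] at this
    simp only [map_sum, map_mul, map_pow]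
    exact this
  have hi' := Polynomial.derivative_mem_of_sum_mem hDI hroot hmul hPR hsum i hi
  have hX : P i - X ∈ I := by
    change 1 ≤ v (aeval b (P i - X))
    rw [map_sub, aeval_X, AddValuation.map_sub_swap]
    exact hP i
  have hone := sub_mem hi' (hDI _ hX)
  rw [derivative_sub, derivative_X, sub_sub_cancel] at hone
  change 1 ≤ v (aeval b 1) at hone
  rw [map_one, AddValuation.map_one] at hone
  exact absurd hone (by norm_num)

end Dense

/-! ### The form attached to a Witt vector and the filtrations -/

theorem zero_le_map_intCast (k : ℤ) : 0 ≤ v (k : K) := by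
  induction k using Int.induction_on with
  | zero => simp
  | succ n h =>
    rw [Int.cast_add, Int.cast_one]
    exact v.map_le_add h (by simp)
  | pred n h =>
    rw [Int.cast_sub, Int.cast_one]
    exact v.map_le_sub h (by simp)

theorem map_intCast_eq_zero {k : ℤ} (hk : ¬ (p : ℤ) ∣ k) : v (k : K) = 0 := by
  refine le_antisymm ?_ (zero_le_map_intCast k)
  obtain ⟨a, b, hab⟩ : IsCoprime (p : ℤ) k :=
    (Nat.prime_iff_prime_int.mp (Fact.out : p.Prime)).coprime_iff_not_dvd.mpr hk
  have h1 : (b : K) * k = 1 := by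
    rw [← Int.cast_mul, ← Int.cast_one, ← hab]
    simp
  calc v (k : K) ≤ v (b : K) + v k := le_add_of_nonneg_left (zero_le_map_intCast b)
    _ = 0 := by rw [← AddValuation.map_mul, h1, AddValuation.map_one]

theorem pow_pred_smul_D_mem {π : K} (hπ : v π = 1) {n : ℕ} (hn : n ≠ 0) {j : ℕ} {b : K}
    (hb : ((-n : ℤ) : WithTop ℤ) ≤ p ^ j • v b)
    (hj : j ≠ padicValNat p n ∨ ((-(n - 1) : ℤ) : WithTop ℤ) ≤ p ^ j • v b) :
    b ^ (p ^ j - 1) • KaehlerDifferential.D (Kp p K) K b ∈ filOmega' p K v π n := by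
  have hp := (Fact.out : p.Prime)
  have hq := pow_ne_zero j hp.ne_zero
  have h0 := uniformizer_ne_zero hπ
  rcases eq_or_ne b 0 with rfl | hb0
  · simp
  obtain ⟨k, hk⟩ := exists_map_eq_coe (v := v) hb0
  obtain ⟨u, hu, rfl⟩ := (le_map_iff_exists hπ).mp hk.ge
  rw [coe_le_nsmul_map_iff hq] at hb hj
  have hbk := hb k hk
  have hu' : ∀ N : ℕ, 0 ≤ v (u ^ N) := fun N => by
    rw [AddValuation.map_pow]
    exact nsmul_nonneg hu N
  rw [pow_pred_smul_D_eq h0 hq, smul_smul]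
  refine add_mem (smul_D_mem_filOmega' hπ ?_ hu) ?_
  · rw [AddValuation.map_mul, map_uniformizer_zpow hπ]
    exact (WithTop.coe_le_coe.mpr hbk).trans (le_add_of_nonneg_right (hu' _))
  by_cases hkn : ((p ^ j : ℕ) : ℤ) * k = -n
  · have hpk : (p : ℤ) ∣ k := by
      have hjn : p ^ j ∣ n := by
        rw [← Int.natCast_dvd_natCast]
        exact Int.dvd_neg.mp ⟨k, hkn.symm⟩
      have hlt : j < padicValNat p n := by
        refine lt_of_le_of_ne ((padicValNat_dvd_iff_le hn).mp hjn) (hj.resolve_right fun h => ?_)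
        have := h k hk
        omega
      have h1 : p ^ (j + 1) ∣ n := (padicValNat_dvd_iff_le hn).mpr hlt
      rw [← Int.natCast_dvd_natCast, ← Int.dvd_neg, ← hkn, pow_succ, Nat.cast_mul] at h1
      exact Int.dvd_of_mul_dvd_mul_left (by exact_mod_cast hq) h1
    rw [(CharP.intCast_eq_zero_iff K p k).mpr hpk, zero_mul, zero_mul, zero_smul]
    exact zero_mem _
  · refine smul_D_mem_filOmega' hπ ?_ (by rw [hπ]; exact zero_le_one)
    rw [AddValuation.map_mul, AddValuation.map_mul, map_uniformizer_zpow hπ]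
    calc ((-n : ℤ) : WithTop ℤ) ≤ ((p ^ j : ℕ) * k - 1 : ℤ) := WithTop.coe_le_coe.mpr (by omega)
      _ ≤ _ := (le_add_of_nonneg_left (zero_le_map_intCast k)).trans (le_add_of_nonneg_right (hu' _))

theorem sumForm_mem_of_mem_filW' {π : K} (hπ : v π = 1) {s n : ℕ} (hn : n ≠ 0)
    {a : TruncatedWittVector p s K} (ha : a ∈ filW' p K v s n) :
    sumForm p K a ∈ filOmega' p K v π n := by
  refine sum_mem fun i _ => pow_pred_smul_D_mem hπ hn (mem_filW_iff.mp (filW'_subset_filW ha) i) ?_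
  have h := mem_filW'_iff.mp ha i
  split_ifs at h with hi
  · exact Or.inl hi.ne
  · exact Or.inr h

theorem mem_filW'_of_sumForm_mem {π : K} (hπ : v π = 1) {s n : ℕ} (hn : n ≠ 0)
    {a : TruncatedWittVector p s K} (ha : a ∈ filW p K v s n)
    (hs : sumForm p K a ∈ filOmega' p K v π n) : a ∈ filW' p K v s n := by
  have hp := (Fact.out : p.Prime)
  have h0 := uniformizer_ne_zero hπ
  have ha' := mem_filW_iff.mp ha
  refine mem_filW'_iff.mpr fun i => ?_
  split_ifs with hi
  · exact ha' i
  by_contra hlt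
  rw [coe_le_nsmul_map_iff (pow_ne_zero _ hp.ne_zero)] at hlt
  push Not at hlt
  obtain ⟨k, hk, hlt⟩ := hlt
  have hle := (coe_le_nsmul_map_iff (pow_ne_zero _ hp.ne_zero)).mp (ha' i) k hk
  set q := p ^ (s - 1 - (i : ℕ)) with hq
  have hkn : ((q : ℕ) : ℤ) * k = -n := by omega
  have he : s - 1 - (i : ℕ) = padicValNat p n := by
    refine le_antisymm ((padicValNat_dvd_iff_le hn).mp ?_) (not_lt.mp hi)
    rw [← Int.natCast_dvd_natCast]
    exact Int.dvd_neg.mp ⟨k, hkn.symm⟩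
  have hpk : ¬ (p : ℤ) ∣ k := by
    intro h
    have h1 : p ^ (padicValNat p n + 1) ∣ n := by
      rw [← Int.natCast_dvd_natCast, ← Int.dvd_neg, ← hkn, pow_succ, hq, he, Nat.cast_mul]
      exact mul_dvd_mul_left _ h
    exact pow_succ_padicValNat_not_dvd hn h1
  have hterm : a.coeff i ^ (q - 1) • KaehlerDifferential.D (Kp p K) K (a.coeff i) ∈
      filOmega' p K v π n := by
    rw [sumForm, ← Finset.add_sum_erase _ _ (Finset.mem_univ i)] at hs
    refine (add_mem_cancel_right (sum_mem fun i' hi' => ?_)).mp hs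
    refine pow_pred_smul_D_mem hπ hn (ha' i') (Or.inl fun h => Finset.ne_of_mem_erase hi' ?_)
    ext
    omega
  obtain ⟨u, hu, hau⟩ := (le_map_iff_exists hπ).mp hk.ge
  have hu0 : v u = 0 := by
    have : u = π ^ (-k) * a.coeff i := by
      rw [hau, ← mul_assoc, ← zpow_add₀ h0]
      simp
    rw [this, AddValuation.map_mul, map_uniformizer_zpow hπ, hk]
    norm_cast
    simp
  have huN : ∀ N : ℕ, v (u ^ N) = 0 := fun N => by rw [AddValuation.map_pow, hu0, smul_zero]
  rw [hau, pow_pred_smul_D_eq h0 (pow_ne_zero _ hp.ne_zero), hkn, smul_smul] at hterm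
  have hlast := le_map_of_smul_D_uniformizer_mem hπ <| (add_mem_cancel_left
    (smul_D_mem_filOmega' hπ (by
      rw [AddValuation.map_mul, huN, map_uniformizer_zpow hπ, add_zero]) hu)).mp hterm
  rw [AddValuation.map_mul, AddValuation.map_mul, huN, map_intCast_eq_zero hpk, zero_add, add_zero,
    map_uniformizer_zpow hπ, WithTop.coe_le_coe] at hlast
  omega

theorem sumForm_eq_sum_rev {s : ℕ} (a : TruncatedWittVector p s K) :
    sumForm p K a = ∑ j : Fin s, a.coeff j.rev ^ (p ^ (j : ℕ) - 1) •
      KaehlerDifferential.D (Kp p K) K (a.coeff j.rev) := by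
  rw [sumForm, ← Equiv.sum_comp Fin.revPerm]
  refine Finset.sum_congr rfl fun i _ => ?_
  rw [Fin.revPerm_apply, Fin.val_rev, show s - 1 - (s - ((i : ℕ) + 1)) = i by omega]

/-- The lift of a Witt vector with small form along `F - 1`, when `p ∣ m`. -/
theorem exists_frobW_sub_mem_filW {π : K} (hπ : v π = 1) {s m : ℕ} (hm : 2 ≤ m) (hpm : p ∣ m)
    {a : TruncatedWittVector p s K} (ha : a ∈ filW' p K v s m)
    (hs : sumForm p K a ∈ filOmega' p K v π ((m : ℤ) - 1)) :
    ∃ c ∈ filW p K v s (m / p : ℕ), a - frobW p K c ∈ filW p K v s ((m : ℤ) - 1) := by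
  have hp := (Fact.out : p.Prime)
  have h0 := uniformizer_ne_zero hπ
  have hm0 : m ≠ 0 := by omega
  have hcoe : ∀ {x : K} {N : ℕ} {c : ℤ}, (c : WithTop ℤ) ≤ p ^ N • v x ↔
      ∀ k : ℤ, v x = k → c ≤ (p ^ N : ℕ) * k := coe_le_nsmul_map_iff (pow_ne_zero _ hp.ne_zero)
  set e := padicValNat p m with he
  have hdvd : ∀ {j}, j ≤ e → p ^ j ∣ m := fun h => (padicValNat_dvd_iff_le hm0).mpr h
  have ha' := mem_filW'_iff.mp ha
  have hrev : ∀ {j : ℕ} (hj : j < s), s - 1 - ((Fin.rev ⟨j, hj⟩ : Fin s) : ℕ) = j := by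
    intro j hj
    rw [Fin.val_rev]
    simp only
    omega
  have hdiv : ∀ {j}, j ≤ e → ((p ^ j : ℕ) : ℤ) * (m / p ^ j : ℕ) = m := fun h => by
    exact_mod_cast Nat.mul_div_cancel' (hdvd h)
  have hp0 : ∀ j, (0 : ℤ) < (p ^ j : ℕ) := fun j => by exact_mod_cast pow_pos hp.pos j
  let u : ℕ → K := fun j =>
    if h : j < s ∧ j < e then π ^ ((m / p ^ j : ℕ) : ℤ) * a.coeff (Fin.rev ⟨j, h.1⟩) else 0
  have hu : ∀ j, 0 ≤ v (u j) := by
    intro j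
    by_cases h : j < s ∧ j < e
    · have h1 := ha' (Fin.rev ⟨j, h.1⟩)
      rw [hrev, if_pos h.2, hcoe] at h1
      simp only [u, dif_pos h]
      rw [AddValuation.map_mul, map_uniformizer_zpow hπ]
      rcases eq_or_ne (a.coeff (Fin.rev ⟨j, h.1⟩)) 0 with h2 | h2
      · simp [h2]
      obtain ⟨k, hk⟩ := exists_map_eq_coe (v := v) h2
      have h3 := h1 k hk
      rw [hk]
      norm_cast
      rw [← hdiv h.2.le, ← mul_neg] at h3
      have := le_of_mul_le_mul_left h3 (hp0 j)
      omega
    · simp [u, dif_neg h]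
  have hsum : ∑ j ∈ Finset.range s, u j ^ (p ^ j - 1) • KaehlerDifferential.D (Kp p K) K (u j) ∈
      filOmega' p K v π (-1) := by
    have h1 : ∀ j : Fin s, a.coeff j.rev ^ (p ^ (j : ℕ) - 1) •
        KaehlerDifferential.D (Kp p K) K (a.coeff j.rev) -
        π ^ (-m : ℤ) • u j ^ (p ^ (j : ℕ) - 1) • KaehlerDifferential.D (Kp p K) K (u j) ∈
        filOmega' p K v π ((m : ℤ) - 1) := by
      intro j
      have h3 := ha' j.rev
      rw [hrev j.2] at h3
      by_cases hj : (j : ℕ) < e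
      · have h2 : a.coeff j.rev = π ^ (-(m / p ^ (j : ℕ) : ℕ) : ℤ) * u j := by
          simp only [u, dif_pos (And.intro j.2 hj)]
          rw [← mul_assoc, ← zpow_add₀ h0]
          simp
        have h4 : (p : ℤ) ∣ -(m / p ^ (j : ℕ) : ℕ) := by
          rw [Int.dvd_neg, Int.natCast_dvd_natCast]
          exact (Nat.dvd_div_iff_mul_dvd (hdvd hj.le)).mpr (by rw [← pow_succ]; exact hdvd hj)
        rw [h2, pow_pred_smul_D_eq h0 (pow_ne_zero _ hp.ne_zero),
          (CharP.intCast_eq_zero_iff K p _).mpr h4, mul_neg, hdiv hj.le]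
        simp
      · rw [if_neg hj] at h3
        have h2 : u j = 0 := by simp [u, hj]
        have hm1 : ((m - 1 : ℕ) : ℤ) = m - 1 := by omega
        have h4 : ¬ p ∣ m - 1 := fun h' => hp.one_lt.ne' <| Nat.dvd_one.mp <| by
          simpa [Nat.sub_sub_self (by omega : 1 ≤ m)] using Nat.dvd_sub hpm h'
        have h5 : e ≠ 0 := fun h => by
          have := (dvd_iff_padicValNat_ne_zero hm0).mp hpm
          omega
        rw [h2, map_zero, smul_zero, smul_zero, sub_zero, ← hm1]
        refine pow_pred_smul_D_mem hπ (by omega) (hm1 ▸ h3) (Or.inl ?_)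
        rw [padicValNat.eq_zero_of_not_dvd h4]
        omega
    have h2 := sub_mem hs (sum_mem fun j (_ : j ∈ Finset.univ) => h1 j)
    rw [Finset.sum_sub_distrib, sumForm_eq_sum_rev, sub_sub_cancel, ← Finset.smul_sum] at h2
    have h3 := smul_mem_filOmega' hπ (n := -m) (c := π ^ (m : ℤ))
      (by rw [map_uniformizer_zpow hπ, neg_neg]) h2
    rw [smul_smul, ← zpow_add₀ h0, add_neg_cancel, zpow_zero, one_smul] at h3
    rw [Finset.sum_range]
    convert h3 using 1
    congr 1
    ring
  choose! w hw0 hw using exists_sub_pow_of_sum_mem hπ hu hsum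
  let c : TruncatedWittVector p s K := mk p fun i =>
    if s - 1 - (i : ℕ) < e then π ^ (-(m / p ^ (s - 1 - (i : ℕ) + 1) : ℕ) : ℤ) *
      w (s - 1 - (i : ℕ)) else 0
  have hc : c ∈ filW p K v s (m / p : ℕ) := by
    refine mem_filW_iff.mpr fun i => ?_
    simp only [c, coeff_mk]
    split_ifs with hi
    · set j := s - 1 - (i : ℕ)
      rw [AddValuation.map_mul, map_uniformizer_zpow hπ, smul_add, nsmul_coe_int]
      refine le_trans (WithTop.coe_le_coe.mpr ?_)
        (le_add_of_nonneg_right (nsmul_nonneg (hw0 j (by omega)) _))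
      rw [mul_neg, neg_le_neg_iff, pow_succ, Nat.mul_comm, ← Nat.div_div_eq_div_mul]
      exact_mod_cast (Nat.mul_div_le (m / p) (p ^ j))
    · rw [hcoe]
      simp
  refine ⟨c, hc, sub_mem_filW_of_coeff_sub (filW'_subset_filW ha) (frobW_mem_filW ?_ hc) ?_⟩
  · exact_mod_cast Nat.mul_div_le m p
  intro i
  have h1 := ha' i
  rw [frobW, coeff_mk]
  simp only [c, coeff_mk]
  split_ifs at h1 ⊢ with hi
  · set j := s - 1 - (i : ℕ) with hj
    have hjs : j < s := by omega
    have h2 : a.coeff i = π ^ (-(m / p ^ j : ℕ) : ℤ) * u j := by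
      simp only [u, dif_pos (And.intro hjs hi)]
      rw [← mul_assoc, ← zpow_add₀ h0, neg_add_cancel, zpow_zero, one_mul]
      congr 1
      ext
      rw [Fin.val_rev]
      simp only [hj]
      omega
    have h3 : ((m / p ^ (j + 1) : ℕ) : ℤ) * p = (m / p ^ j : ℕ) := by
      have h4 := hdiv hi.le
      rw [← hdiv (Nat.succ_le_of_lt hi), pow_succ, Nat.cast_mul, mul_assoc] at h4
      rw [mul_comm]
      exact (mul_left_cancel₀ (hp0 j).ne' h4).symm
    have h5 := hw j hjs
    rw [mul_pow, ← zpow_natCast (π ^ _), ← zpow_mul, neg_mul, h3, h2, ← mul_sub,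
      AddValuation.map_mul, map_uniformizer_zpow hπ, smul_add, nsmul_coe_int, mul_neg, hdiv hi.le,
      WithTop.coe_add]
    gcongr
    calc ((1 : ℤ) : WithTop ℤ) ≤ v (u j - w j ^ p) := h5
      _ = 1 • v (u j - w j ^ p) := (one_nsmul _).symm
      _ ≤ _ := nsmul_le_nsmul_left (zero_le_one.trans h5) (Nat.one_le_pow _ _ hp.pos)
  · rw [zero_pow hp.ne_zero, sub_zero]
    exact le_of_eq_of_le (by ring_nf) h1

theorem sumForm_mem_iff {π : K} (hπ : v π = 1) {s m : ℕ} (hm : 2 ≤ m) (hpm : ¬(p = 2 ∧ m = 2))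
    {a : TruncatedWittVector p s K} (ha : a ∈ filW' p K v s m) :
    sumForm p K a ∈ filOmega' p K v π ((m : ℤ) - 1) ↔
      ∃ b ∈ filW' p K v s (m - 1), ∃ c ∈ filW'' p K v s m, a = b + (frobW p K c - c) := by
  have hp := (Fact.out : p.Prime)
  have hm1 : ((m - 1 : ℕ) : ℤ) = m - 1 := by omega
  have h2 := hp.div_add_two_le hm hpm
  have hc' : filW p K v s (m / p : ℕ) ⊆ filW' p K v s (m - 1) :=
    (filW_mono (by omega)).trans filW_subset_filW'
  rw [filW''_eq (by omega), ← hm1]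
  constructor
  · intro hs
    by_cases h : p ∣ m
    · obtain ⟨c, hc, hac⟩ := exists_frobW_sub_mem_filW hπ hm h ha (hm1 ▸ hs)
      have h1 : ¬ p ∣ m - 1 := fun h' => hp.one_lt.ne' <| Nat.dvd_one.mp <| by
        simpa [Nat.sub_sub_self (by omega : 1 ≤ m)] using Nat.dvd_sub h h'
      have h3 : a - frobW p K c ∈ filW' p K v s (m - 1) := by
        refine mem_filW'_of_sumForm_mem hπ (by omega) (hm1 ▸ hac) ?_
        rwa [sumForm_sub, sumForm_frobW, sub_zero]
      have h4 := hc' hc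
      rw [filW'_eq_of_not_dvd h1] at h3 h4 ⊢
      exact ⟨_, add_mem_filW h3 h4, c, hc, by abel⟩
    · refine ⟨a, mem_filW'_of_sumForm_mem hπ (by omega) ?_ hs, 0, zero_mem_filW, ?_⟩
      · rwa [hm1, ← filW'_eq_of_not_dvd h]
      · have : frobW p K (0 : TruncatedWittVector p s K) = 0 := by
          ext i
          simp [frobW, hp.ne_zero]
        simp [this]
  · rintro ⟨b, hb, c, hc, rfl⟩
    rw [sumForm_add, sumForm_sub, sumForm_frobW, zero_sub]
    exact add_mem (sumForm_mem_of_mem_filW' hπ (by omega) hb)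
      (neg_mem (sumForm_mem_of_mem_filW' hπ (by omega) (hc' hc)))

end

/-- Lemma 1.20 of the paper.  Let `m ≥ 2` with `(p, m) ≠ (2, 2)`.
(a) If `x ∈ fil''_m W_s(K)` and `F x - x ∈ fil'_{m-1} W_s(K)` then
`x ∈ fil''_{m-1} W_s(K)` (so `F - 1` induces an injection
`fil''_m/fil''_{m-1} → fil'_m/fil'_{m-1}`).
(b) For `a = (a_{s-1}, …, a_0) ∈ fil'_m W_s(K)` one has
`∑ a_i^{p^i - 1} da_i ∈ fil'_{m-1} Ω¹_K` iff
`a ∈ fil'_{m-1} W_s(K) + (F-1)(fil''_m W_s(K))`.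
Together these express the exactness of
`0 → fil''_m/fil''_{m-1} → fil'_m/fil'_{m-1} → fil'_mΩ¹_K/fil'_{m-1}Ω¹_K`. -/
theorem statement10 (s m : ℕ) (hm : 2 ≤ m) (hpm : ¬(p = 2 ∧ m = 2))
    (π : K) (hπ : v π = 1) :
    (∀ x ∈ filW'' p K v s m,
        frobW p K x - x ∈ filW' p K v s (m - 1) → x ∈ filW'' p K v s (m - 1)) ∧
    (∀ a ∈ filW' p K v s m,
        (sumForm p K a ∈ filOmega' p K v π ((m : ℤ) - 1) ↔
          ∃ b ∈ filW' p K v s (m - 1),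
            ∃ c ∈ filW'' p K v s m, a = b + (frobW p K c - c))) :=
  ⟨fun _ hx h => mem_filW''_pred hm hpm hx h, fun _ ha => sumForm_mem_iff hπ hm hpm ha⟩
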